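/- arXiv:2601.12565 — 4 statements merged into one kernel-verified Lean document; each statement's English description precedes it below -/
import Mathlib

section
/- Let p be a prime and let R be a commutative ring in which p is nilpotent such that the reduced quotient R/nilradical(R) is seminormal. Then for every faithfully flat ring homomorphism R → R', every Čech 1-cocycle of Ŵ is a coboundary: if x ∈ Ŵ(R' ⊗_R R') satisfies d(x) = 0 in Ŵ(R' ⊗_R R' ⊗_R R') (alternating sum of the three maps induced by inserting 1 into a tensor position), then x = d(y) for some y ∈ Ŵ(R') (difference of the two maps induced by the inclusions of R' into R' ⊗_R R'). Equivalently, the first Čech cohomology Ȟ¹(R'/R, Ŵ) vanishes. -/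
/-!
STATEMENT 0: Let p be a prime and let R be a p-nilpotent commutative ring such that
R/nilradical(R) is seminormal.  Then for every faithfully flat ring homomorphism
R → R', every Čech 1-cocycle of Ŵ is a coboundary, i.e. Ȟ¹(R'/R, Ŵ) = 0.
-/

open TensorProduct

universe u

/-- `Ŵ(S)`: the Witt vectors all of whose coefficients are nilpotent and all but
finitely many of whose coefficients are zero. -/
def IsHatW (p : ℕ) [Fact p.Prime] {S : Type u} [CommRing S] (x : WittVector p S) : Prop :=
  (∀ n, IsNilpotent (x.coeff n)) ∧ ∃ N, ∀ n ≥ N, x.coeff n = 0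

/-- A reduced commutative ring `T` is seminormal if for all `x, y` with `x³ = y²`
there is `s` with `s² = x` and `s³ = y`. -/
def IsSeminormalRing (T : Type*) [CommRing T] : Prop :=
  IsReduced T ∧ ∀ x y : T, x ^ 3 = y ^ 2 → ∃ s : T, s ^ 2 = x ∧ s ^ 3 = y

/-- A bundled commutative `R`-algebra. -/
structure CommAlgebraBundle (R : Type u) [CommRing R] : Type (u + 1) where
  carrier : Type u
  [commRing : CommRing carrier]
  [algebra : Algebra R carrier]

attribute [instance] CommAlgebraBundle.commRing CommAlgebraBundle.algebra

variable {R : Type u} [CommRing R]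

/-- `cechAlg R' n` is the `(n+1)`-fold tensor power `R' ⊗_R ⋯ ⊗_R R'`. -/
noncomputable def cechAlg (R' : Type u) [CommRing R'] [Algebra R R'] : ℕ → CommAlgebraBundle R
  | 0 => CommAlgebraBundle.mk R'
  | n + 1 => CommAlgebraBundle.mk ((cechAlg R' n).carrier ⊗[R] R')

/-- The `R`-algebra map inserting `1` into the `i`-th tensor position. -/
noncomputable def cechIns (R' : Type u) [CommRing R'] [Algebra R R'] :
    (n : ℕ) → Fin (n + 2) →
      ((cechAlg (R := R) R' n).carrier →ₐ[R] (cechAlg (R := R) R' (n + 1)).carrier)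
  | 0, i =>
      Fin.cases Algebra.TensorProduct.includeRight
        (fun _ => Algebra.TensorProduct.includeLeft) i
  | n + 1, i =>
      Fin.lastCases Algebra.TensorProduct.includeLeft
        (fun j => Algebra.TensorProduct.map (cechIns R' n j) (AlgHom.id R R')) i

/-- The Čech differential `W(R'^{⊗ n+1}) → W(R'^{⊗ n+2})`, the alternating sum of the
maps induced by inserting `1` into the possible tensor positions. -/
noncomputable def cechWittD (p : ℕ) [Fact p.Prime] (R' : Type u) [CommRing R'] [Algebra R R']
    (n : ℕ) :
    WittVector p (cechAlg (R := R) R' n).carrier →+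
      WittVector p (cechAlg (R := R) R' (n + 1)).carrier :=
  ∑ i : Fin (n + 2),
    (-1 : ℤ) ^ (i : ℕ) •
      (WittVector.map (p := p) ((cechIns (R := R) R' n i) : _ →+* _)).toAddMonoidHom

section stageA
open Polynomial

/-- element of a minimal prime over `I` is nilpotent mod `I` after localisation. -/
lemma exists_notMem_mul_pow_mem {B : Type*} [CommRing B] {I 𝔭 : Ideal B} (h : 𝔭 ∈ I.minimalPrimes)
    {x : B} (hx : x ∈ 𝔭) : ∃ s ∉ 𝔭, ∃ n : ℕ, s * x ^ n ∈ I := by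
  have hp : 𝔭.IsPrime := h.1.1
  by_contra! hcon
  have hd : Disjoint (I : Set B) ((𝔭.primeCompl ⊔ Submonoid.powers x : Submonoid B) : Set B) := by
    rw [Set.disjoint_left]
    intro y hy hy'
    obtain ⟨s, hs, z, ⟨n, rfl⟩, rfl⟩ := Submonoid.mem_sup.1 hy'
    exact hcon s hs n hy
  obtain ⟨q, hq, hIq, hqd⟩ := Ideal.exists_le_prime_disjoint I _ hd
  have hle : q ≤ 𝔭 := by
    intro y hy
    by_contra hyp
    exact Set.disjoint_left.1 hqd hy
      ((le_sup_left : 𝔭.primeCompl ≤ 𝔭.primeCompl ⊔ Submonoid.powers x) hyp)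
  have := h.2 ⟨hq, hIq⟩ hle hx
  exact Set.disjoint_left.1 hqd this
    ((le_sup_right : Submonoid.powers x ≤ 𝔭.primeCompl ⊔ Submonoid.powers x) ⟨1, by simp⟩)

/-- field case of Traverso. -/
lemma traverso_field {κ : Type*} [Field κ] (k : Subfield κ) {n : ℕ} (a b : Fin n → κ[X])
    (hab : ∀ i j, ∃ m : k[X], m.map k.subtype = a i * b j)
    (h1 : ∑ i, a i * b i = 1)
    (ha : ∀ i, (a i).coeff 0 ∈ k)  (i : Fin n) :
    ∃ m : k[X], m.map k.subtype = a i := by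
  classical
  choose m hm using hab
  obtain ⟨j, hj⟩ : ∃ j, b j ≠ 0 := by
    by_contra! hcon
    simp [hcon] at h1
  let I : Ideal k[X] := Ideal.span (Set.range fun i => m i j)
  obtain ⟨G, hG⟩ : ∃ G, I = Ideal.span {G} := (IsPrincipalIdealRing.principal I).principal
  have hGI : G ∈ I := by rw [hG]; exact Ideal.mem_span_singleton_self G
  obtain ⟨c, hc⟩ := (Ideal.mem_span_range_iff_exists_fun).1 hGI
  have hd : ∀ i, ∃ d, m i j = G * d := fun i => by
    have : m i j ∈ I := Ideal.subset_span ⟨i, rfl⟩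
    rw [hG, Ideal.mem_span_singleton] at this
    exact this
  choose d hd using hd
  let w : κ[X] := ∑ i, (c i).map k.subtype * a i
  have hGw : G.map k.subtype = b j * w := by
    rw [← hc, Polynomial.map_sum, Finset.mul_sum]
    refine Finset.sum_congr rfl fun i _ => ?_
    rw [Polynomial.map_mul, hm]; ring
  have haw : ∀ i, a i = w * (d i).map k.subtype := fun i => by
    have := congrArg (Polynomial.map k.subtype) (hd i)
    rw [hm, Polynomial.map_mul, hGw] at this
    apply mul_left_cancel₀ hj
    linear_combination this
  have hwu : IsUnit w := by
    refine IsUnit.of_mul_eq_one (∑ i, (d i).map k.subtype * b i) ?_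
    rw [← h1, Finset.mul_sum]
    refine Finset.sum_congr rfl fun i _ => ?_
    conv_rhs => rw [haw i]
    ring
  obtain ⟨r, _, hr⟩ := Polynomial.isUnit_iff.1 hwu
  have hrk : r ∈ k := by
    have : r = w.coeff 0 := by rw [← hr]; simp
    rw [this]
    simp only [w, Polynomial.finsetSum_coeff, Polynomial.mul_coeff_zero]
    refine Subfield.sum_mem _ fun i _ => Subfield.mul_mem _ ?_ (ha i)
    simp
  refine ⟨C ⟨r, hrk⟩ * d i, ?_⟩
  rw [haw i, ← hr]
  simp

/-- Finite descent statement behind Traverso's theorem. -/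
theorem traverso {A : Type*} [CommRing A] (B : Subring A) (q : ℕ) (hq : 0 < q)
    (hqpow : ∀ x : A, x ^ q ∈ B)
    (hsn : ∀ x : A, x ^ 2 ∈ B → x ^ 3 ∈ B → x ∈ B)
    {n : ℕ} (a b : Fin n → A[X])
    (hab : ∀ i j m, (a i * b j).coeff m ∈ B)
    (h1 : ∑ i, a i * b i = 1)
    (ha : ∀ i, (a i).coeff 0 ∈ B) (hb : ∀ i, (b i).coeff 0 ∈ B) :
    (∀ i m, (a i).coeff m ∈ B) ∧ (∀ i m, (b i).coeff m ∈ B) := by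
  classical
  let S : Finset A := (Finset.univ.biUnion fun i => (a i).coeffs) ∪
    (Finset.univ.biUnion fun i => (b i).coeffs)
  suffices hS : ∀ x ∈ S, x ∈ B by
    have key : ∀ f : A[X], (∀ x ∈ f.coeffs, x ∈ B) → ∀ m, f.coeff m ∈ B := fun f hf m => by
      by_cases h0 : f.coeff m = 0
      · rw [h0]; exact B.zero_mem
      · exact hf _ (Polynomial.coeff_mem_coeffs h0)
    constructor
    · exact fun i => key _ fun x hx => hS x (by
        simp only [S, Finset.mem_union, Finset.mem_biUnion]; exact Or.inl ⟨i, Finset.mem_univ _, hx⟩)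
    · exact fun i => key _ fun x hx => hS x (by
        simp only [S, Finset.mem_union, Finset.mem_biUnion]; exact Or.inr ⟨i, Finset.mem_univ _, hx⟩)
  -- the finite extension
  let A₀ : Subalgebra B A := Algebra.adjoin B (S : Set A)
  -- conductor
  let 𝔠 : Ideal B :=
    { carrier := {r | ∀ x ∈ A₀, (r : A) * x ∈ B}
      add_mem' := fun {r s} hr hs x hx => by
        have := B.add_mem (hr x hx) (hs x hx)
        simpa [add_mul] using this
      zero_mem' := fun x hx => by simp
      smul_mem' := fun c r hr x hx => by
        have := B.mul_mem c.2 (hr x hx)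
        simpa [mul_assoc] using this }
  have hc_def : ∀ r : B, r ∈ 𝔠 ↔ ∀ x ∈ A₀, (r : A) * x ∈ B := fun r => Iff.rfl
  -- radical
  have hrad2 : ∀ y ∈ A₀, (∀ x ∈ A₀, y ^ 2 * x ∈ B) → ∀ x ∈ A₀, y * x ∈ B := by
    intro y hy h x hx
    apply hsn
    · rw [mul_pow]; exact h _ (pow_mem hx 2)
    · have : (y * x) ^ 3 = y ^ 2 * (y * x ^ 3) := by ring
      rw [this]; exact h _ (mul_mem hy (pow_mem hx 3))
  have hrad : ∀ (k : ℕ) (y), y ∈ A₀ → (∀ x ∈ A₀, y ^ (2 ^ k) * x ∈ B) → ∀ x ∈ A₀, y * x ∈ B := by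
    intro k
    induction k with
    | zero => intro y hy h; simpa using h
    | succ k ih =>
      intro y hy h
      apply ih y hy
      apply hrad2 _ (pow_mem hy _)
      intro x hx
      rw [← pow_mul, ← pow_succ]
      exact h x hx
  have hradN : ∀ (N : ℕ) (y), y ∈ A₀ → (∀ x ∈ A₀, y ^ N * x ∈ B) → ∀ x ∈ A₀, y * x ∈ B := by
    intro N y hy h
    apply hrad N y hy
    intro x hx
    have hlt : N ≤ 2 ^ N := Nat.lt_two_pow_self.le
    have : y ^ (2 ^ N) * x = y ^ N * (y ^ (2 ^ N - N) * x) := by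
      rw [← mul_assoc, ← pow_add]; congr 2; omega
    rw [this]
    exact h _ (mul_mem (pow_mem hy _) hx)
  -- finite generation
  have hfin : ∀ s : B, (∀ x ∈ S, (s : A) * x ∈ B) → ∃ N : ℕ, s ^ N ∈ 𝔠 := by
    intro s hs
    have hFG : (Subalgebra.toSubmodule A₀).FG := by
      apply fg_adjoin_of_finite S.finite_toSet
      intro x _
      refine ⟨X ^ q - C ⟨x ^ q, hqpow x⟩, monic_X_pow_sub_C _ hq.ne', ?_⟩
      simp only [eval₂_sub, eval₂_X_pow, eval₂_C]
      exact sub_self _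
    have hpow : ∀ x ∈ A₀, ∃ N : ℕ, (s : A) ^ N * x ∈ B := by
      intro x hx
      induction hx using Algebra.adjoin_induction with
      | mem x hx => exact ⟨1, by simpa using hs x hx⟩
      | algebraMap r => exact ⟨0, by rw [pow_zero, one_mul]; exact r.2⟩
      | add x y _ _ hx hy =>
        obtain ⟨N, hN⟩ := hx
        obtain ⟨M, hM⟩ := hy
        refine ⟨N + M, ?_⟩
        have : (s : A) ^ (N + M) * (x + y) = (s : A) ^ M * ((s : A) ^ N * x) +
          (s : A) ^ N * ((s : A) ^ M * y) := by ring
        rw [this]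
        exact B.add_mem (B.mul_mem (pow_mem s.2 _) hN) (B.mul_mem (pow_mem s.2 _) hM)
      | mul x y _ _ hx hy =>
        obtain ⟨N, hN⟩ := hx
        obtain ⟨M, hM⟩ := hy
        refine ⟨N + M, ?_⟩
        have : (s : A) ^ (N + M) * (x * y) = ((s : A) ^ N * x) * ((s : A) ^ M * y) := by ring
        rw [this]
        exact B.mul_mem hN hM
    obtain ⟨G, hG⟩ := hFG
    have hGA : ∀ g ∈ G, g ∈ A₀ := fun g hg => by
      have : g ∈ Subalgebra.toSubmodule A₀ := hG ▸ Submodule.subset_span hg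
      exact this
    choose! N hN using hpow
    refine ⟨∑ g ∈ G, N g, ?_⟩
    rw [hc_def]
    intro x hx
    have hx' : x ∈ Submodule.span B (G : Set A) := by rw [hG]; exact hx
    induction hx' using Submodule.span_induction with
    | mem x h =>
      have hle : N x ≤ ∑ g ∈ G, N g := Finset.single_le_sum (fun _ _ => Nat.zero_le _) h
      have : ((s ^ (∑ g ∈ G, N g) : B) : A) * x
          = (s : A) ^ ((∑ g ∈ G, N g) - N x) * ((s : A) ^ N x * x) := by
        rw [← mul_assoc, ← pow_add, Nat.sub_add_cancel hle]; simp
      rw [this]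
      exact B.mul_mem (pow_mem s.2 _) (hN x (hGA x h))
    | zero => simp
    | add x y hx1 hy1 h1 h2 =>
      rw [hG] at hx1 hy1
      rw [mul_add]; exact B.add_mem (h1 hx1) (h2 hy1)
    | smul r x hx1 h1 =>
      rw [hG] at hx1
      have := B.mul_mem r.2 (h1 hx1)
      rw [Subring.smul_def, smul_eq_mul, mul_left_comm]
      exact this
  have hSA : ∀ x ∈ S, x ∈ A₀ := fun x hx => Algebra.subset_adjoin hx
  -- main claim
  have htop : 𝔠 = ⊤ := by
    by_contra hne
    obtain ⟨M, hM, hcM⟩ := Ideal.exists_le_maximal 𝔠 hne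
    have := hM.isPrime
    obtain ⟨𝔭, h𝔭, _⟩ := Ideal.exists_minimalPrimes_le hcM
    have hpr : 𝔭.IsPrime := h𝔭.1.1
    have hAB : Algebra.IsIntegral B A := ⟨fun x => by
      refine ⟨X ^ q - C ⟨x ^ q, hqpow x⟩, monic_X_pow_sub_C _ hq.ne', ?_⟩
      simp only [eval₂_sub, eval₂_X_pow, eval₂_C]
      exact sub_self _⟩
    obtain ⟨𝔓, -, h𝔓, h𝔓c⟩ := Ideal.exists_ideal_over_prime_of_isIntegral (S := A) 𝔭 ⊥ (by
      intro x hx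
      have : (x : A) = 0 := hx
      have : x = 0 := Subtype.ext this
      rw [this]; exact 𝔭.zero_mem)
    have hmem𝔓 : ∀ r : B, (r : A) ∈ 𝔓 ↔ r ∈ 𝔭 := fun r => by rw [← h𝔓c]; exact Iff.rfl
    let κ := FractionRing (A ⧸ 𝔓)
    let φ : A →+* κ := (algebraMap (A ⧸ 𝔓) κ).comp (Ideal.Quotient.mk 𝔓)
    have hφ : ∀ x, φ x = 0 ↔ x ∈ 𝔓 := fun x => by
      simp only [φ, RingHom.comp_apply]
      rw [map_eq_zero_iff _ (IsFractionRing.injective (A ⧸ 𝔓) κ), Ideal.Quotient.eq_zero_iff_mem]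
    let k : Subfield κ := Subfield.closure (B.map φ : Set κ)
    have hBk : ∀ x ∈ B, φ x ∈ k := fun x hx => Subfield.subset_closure ⟨x, hx, rfl⟩
    have hden : ∀ x : A, φ x ∈ k → ∃ s : B, s ∉ 𝔭 ∧ ∃ r : B, (s : A) * x - r ∈ 𝔓 := by
      intro x hx
      obtain ⟨y, hy, z, hz, hyz⟩ := Subfield.mem_closure_iff.1 hx
      rw [Subring.closure_eq] at hy hz
      obtain ⟨r, hr, rfl⟩ := hy
      obtain ⟨s, hs, rfl⟩ := hz
      by_cases h0 : φ s = 0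
      · rw [h0, div_zero] at hyz
        refine ⟨1, fun h => hpr.ne_top ((Ideal.eq_top_iff_one _).2 h), 0, ?_⟩
        simpa using (hφ x).1 hyz.symm
      · refine ⟨⟨s, hs⟩, fun h => h0 ((hφ s).2 ((hmem𝔓 ⟨s, hs⟩).2 h)), ⟨r, hr⟩, ?_⟩
        rw [← hφ, map_sub, map_mul, ← hyz]
        rw [mul_div_cancel₀ _ h0, sub_self]
    have hcoef : ∀ f : A[X], (∃ m : k[X], m.map k.subtype = f.map φ) ↔ ∀ j, φ (f.coeff j) ∈ k := by
      intro f
      constructor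
      · rintro ⟨m, hm⟩ j
        rw [← Polynomial.coeff_map, ← hm, Polynomial.coeff_map]
        exact (m.coeff j).2
      · intro h
        have : f.map φ ∈ Polynomial.lifts k.subtype := by
          rw [Polynomial.lifts_iff_coeff_lifts]
          intro j
          rw [Polynomial.coeff_map]
          exact ⟨⟨_, h j⟩, rfl⟩
        exact (Polynomial.mem_lifts _).1 this
    have hak : ∀ i j, φ ((a i).coeff j) ∈ k := by
      intro i
      rw [← hcoef]
      refine traverso_field k (fun i => (a i).map φ) (fun i => (b i).map φ) ?_ ?_ ?_ i
      · intro i j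
        rw [← Polynomial.map_mul, hcoef]
        exact fun m => hBk _ (hab i j m)
      · simp_rw [← Polynomial.map_mul]
        rw [← Polynomial.map_sum, h1, Polynomial.map_one]
      · intro i; rw [Polynomial.coeff_map]; exact hBk _ (ha i)
    have hbk : ∀ i j, φ ((b i).coeff j) ∈ k := by
      intro i
      rw [← hcoef]
      refine traverso_field k (fun i => (b i).map φ) (fun i => (a i).map φ) ?_ ?_ ?_ i
      · intro i j
        rw [← Polynomial.map_mul, hcoef, mul_comm]
        exact fun m => hBk _ (hab j i m)
      · simp_rw [← Polynomial.map_mul]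
        rw [← Polynomial.map_sum]
        simp_rw [mul_comm (b _)]
        rw [h1, Polynomial.map_one]
      · intro i; rw [Polynomial.coeff_map]; exact hBk _ (hb i)
    have hSk : ∀ x ∈ S, φ x ∈ k := by
      intro x hx
      simp only [S, Finset.mem_union, Finset.mem_biUnion, Finset.mem_univ, true_and,
        Polynomial.mem_coeffs_iff] at hx
      rcases hx with ⟨i, j, _, rfl⟩ | ⟨i, j, _, rfl⟩
      · exact hak i j
      · exact hbk i j
    have hs : ∀ x ∈ S, ∃ s : B, s ∉ 𝔭 ∧ (s : A) * x ∈ B := by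
      intro x hx
      obtain ⟨s, hs, r, hr⟩ := hden x (hSk x hx)
      set y : A := (s : A) * x - r with hy
      have hyA : y ∈ A₀ := sub_mem (mul_mem (A₀.algebraMap_mem s) (hSA x hx)) (A₀.algebraMap_mem r)
      have hyp : (⟨y ^ q, hqpow y⟩ : B) ∈ 𝔭 := by
        rw [← hmem𝔓]; exact Ideal.pow_mem_of_mem _ hr _ hq
      obtain ⟨t, ht, N, hN⟩ := exists_notMem_mul_pow_mem h𝔭 hyp
      have h2 : ∀ z ∈ A₀, ((t : A) * y) ^ (q * N + 1) * z ∈ B := by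
        intro z hz
        have e : ((t : A) * y) ^ (q * N + 1) * z =
          ((t * (⟨y ^ q, hqpow y⟩ : B) ^ N : B) : A) * ((t : A) ^ (q * N) * y * z) := by
          push_cast
          rw [← pow_mul, mul_pow, pow_succ, pow_succ]
          ring
        rw [e]
        exact (hc_def _).1 hN _ (mul_mem (mul_mem (pow_mem (A₀.algebraMap_mem t) _) hyA) hz)
      have h3 := hradN _ _ (mul_mem (A₀.algebraMap_mem t) hyA) h2 1 A₀.one_mem
      refine ⟨t * s, fun h => (hpr.mem_or_mem h).elim ht hs, ?_⟩
      have e : ((t * s : B) : A) * x = (algebraMap B A t * y * 1) + t * r := by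
        rw [hy]; change (t : A) * s * x = (t : A) * _ * 1 + _; ring
      rw [e]
      exact B.add_mem h3 (B.mul_mem t.2 r.2)
    choose! σ hσ1 hσ2 using hs
    let s : B := ∏ x ∈ S, σ x
    have hsp : s ∉ 𝔭 := by
      intro h
      obtain ⟨x, hx, h'⟩ := (Ideal.IsPrime.prod_mem_iff).1 h
      exact hσ1 x hx h'
    obtain ⟨N, hN⟩ := hfin s (by
      intro x hx
      have : ((s : B) : A) * x = ((∏ y ∈ S.erase x, σ y : B) : A) * ((σ x : A) * x) := by
        simp only [s]
        rw [← Finset.mul_prod_erase S σ hx]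
        push_cast; ring
      rw [this]
      exact B.mul_mem (Subtype.coe_prop _) (hσ2 x hx))
    exact hsp (hpr.mem_of_pow_mem N (h𝔭.1.2 hN))
  intro x hx
  have h1c : (1 : B) ∈ 𝔠 := htop ▸ Submodule.mem_top
  simpa using (hc_def 1).1 h1c x (hSA x hx)

end stageA

section stageB
open Polynomial TensorProduct

section descent
variable {S S' : Type*} [CommRing S] [CommRing S'] [Algebra S S']

open Algebra.TensorProduct in
/-- the twisted difference. -/
noncomputable def twistDelta (u : S' ⊗[S] S') : S' →ₗ[S] S' ⊗[S] S' :=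
  includeRight.toLinearMap - (LinearMap.mulLeft S u).comp includeLeft.toLinearMap

lemma twistDelta_apply (u : S' ⊗[S] S') (f : S') :
    twistDelta u f = 1 ⊗ₜ f - u * (f ⊗ₜ 1) := rfl

open Algebra.TensorProduct in
lemma descent_half [Module.FaithfullyFlat S S'] (u w : S' ⊗[S] S') (huw : u * w = 1)
    (hc : Algebra.TensorProduct.map (AlgHom.id S S') includeRight u =
      (includeRight u : S' ⊗[S] (S' ⊗[S] S')) *
        Algebra.TensorProduct.map (AlgHom.id S S') includeLeft u) :
    Ideal.span {f : S' | (1 : S') ⊗ₜ[S] f = u * (f ⊗ₜ 1)} = ⊤ := by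
  have h1 : ∀ z : S' ⊗[S] S', LinearMap.lTensor S' (twistDelta u) z =
      Algebra.TensorProduct.map (AlgHom.id S S') includeRight z -
      (includeRight u : S' ⊗[S] (S' ⊗[S] S')) *
        Algebra.TensorProduct.map (AlgHom.id S S') includeLeft z := by
    intro z
    induction z with
    | zero => simp
    | add x y hx hy => rw [map_add, hx, hy, map_add, map_add]; ring
    | tmul a b =>
      simp [twistDelta_apply, TensorProduct.tmul_sub]
  have hk : LinearMap.lTensor S' (twistDelta u) u = 0 := by rw [h1, hc, sub_self]
  have hex := Module.Flat.lTensor_exact S' (LinearMap.exact_subtype_ker_map (twistDelta u))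
  obtain ⟨t, ht⟩ := (hex u).1 hk
  have hm : lmul' (S := S') S u = 1 := by
    let m3 : S' ⊗[S] (S' ⊗[S] S') →ₐ[S] S' :=
      (lmul' (S := S') S).comp (Algebra.TensorProduct.map (AlgHom.id S S') (lmul' (S := S') S))
    have e1 : m3.comp (Algebra.TensorProduct.map (AlgHom.id S S') includeRight)
      = lmul' (S := S') S := by
      ext <;> simp [m3]
    have e2 : m3.comp (Algebra.TensorProduct.map (AlgHom.id S S') includeLeft)
      = lmul' (S := S') S := by
      ext <;> simp [m3]
    have e3 : m3.comp (includeRight) = lmul' (S := S') S := by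
      ext <;> simp [m3]
    have := congrArg m3 hc
    rw [map_mul, ← AlgHom.comp_apply, ← AlgHom.comp_apply, ← AlgHom.comp_apply, e1, e2, e3] at this
    have hu : lmul' (S := S') S u * lmul' (S := S') S w = 1 := by rw [← map_mul, huw, map_one]
    linear_combination (1 - lmul' (S := S') S u) * hu - (lmul' (S := S') S w) * this
  rw [Ideal.eq_top_iff_one]
  suffices H : ∀ t : S' ⊗[S] (LinearMap.ker (twistDelta u)),
      lmul' (S := S') S (LinearMap.lTensor S' (LinearMap.ker (twistDelta u)).subtype t) ∈
        Ideal.span {f : S' | (1 : S') ⊗ₜ[S] f = u * (f ⊗ₜ 1)} by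
    have := H t
    rwa [ht, hm] at this
  intro t
  induction t with
  | zero => simp
  | add x y hx hy => rw [map_add, map_add]; exact Ideal.add_mem _ hx hy
  | tmul a b =>
    simp only [LinearMap.lTensor_tmul, lmul'_apply_tmul, Submodule.subtype_apply]
    apply Ideal.mul_mem_left
    apply Ideal.subset_span
    have := b.2
    rw [LinearMap.mem_ker, twistDelta_apply, sub_eq_zero] at this
    exact this

lemma mem_range_of_eq [Module.FaithfullyFlat S S'] (x : S')
    (h : (1 : S') ⊗ₜ[S] x = x ⊗ₜ 1) : ∃ s, algebraMap S S' s = x := by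
  have := Algebra.IsEffective.of_faithfullyFlat S S'
  exact (this x).1 (by simp [h])

lemma exists_fin_of_mem_mul {L L' : Submodule S S'} {x : S'} (hx : x ∈ L * L') :
    ∃ (n : ℕ) (f g : Fin n → S'), (∀ i, f i ∈ L) ∧ (∀ i, g i ∈ L') ∧ ∑ i, f i * g i = x := by
  induction hx using Submodule.mul_induction_on' with
  | mem_mul_mem m hm n hn => exact ⟨1, fun _ => m, fun _ => n, by simp [hm], by simp [hn], by simp⟩
  | add x hx y hy h1 h2 =>
    obtain ⟨n, f, g, hf, hg, e⟩ := h1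
    obtain ⟨n', f', g', hf', hg', e'⟩ := h2
    refine ⟨n + n', Fin.append f f', Fin.append g g', ?_, ?_, ?_⟩
    · intro i; refine Fin.addCases (fun i => ?_) (fun i => ?_) i <;> simp [hf, hf']
    · intro i; refine Fin.addCases (fun i => ?_) (fun i => ?_) i <;> simp [hg, hg']
    · simp [Fin.sum_univ_add, e, e']

open Algebra.TensorProduct in
theorem descent_unit [Module.FaithfullyFlat S S'] (u w : S' ⊗[S] S') (huw : u * w = 1)
    (hc : Algebra.TensorProduct.map (AlgHom.id S S') includeRight u =
      (includeRight u : S' ⊗[S] (S' ⊗[S] S')) *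
        Algebra.TensorProduct.map (AlgHom.id S S') includeLeft u) :
    ∃ (n : ℕ) (f g : Fin n → S'), ∑ i, f i * g i = 1 ∧
      (∀ i, (1 : S') ⊗ₜ[S] f i = u * (f i ⊗ₜ 1)) ∧ (∀ i, u * ((1 : S') ⊗ₜ[S] g i) = g i ⊗ₜ 1) := by
  have hu := descent_half u w huw hc
  have hw := descent_half w u (by rw [mul_comm, huw]) (by
    have a1 : Algebra.TensorProduct.map (AlgHom.id S S') includeRight u * 
      Algebra.TensorProduct.map (AlgHom.id S S')
        (includeRight : S' →ₐ[S] S' ⊗[S] S') w = 1 := by rw [← map_mul, huw, map_one]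
    have a2 : Algebra.TensorProduct.map (AlgHom.id S S') includeLeft u * 
      Algebra.TensorProduct.map (AlgHom.id S S') 
        (includeLeft : S' →ₐ[S] S' ⊗[S] S') w = 1 := by rw [← map_mul, huw, map_one]
    have a3 : includeRight u * (includeRight w : S' ⊗[S] (S' ⊗[S] S')) = 1 := by
      rw [← map_mul, huw, map_one]
    generalize Algebra.TensorProduct.map (AlgHom.id S S')
      (includeRight : S' →ₐ[S] S' ⊗[S] S') u = A1 at *
    generalize Algebra.TensorProduct.map (AlgHom.id S S')
      (includeRight : S' →ₐ[S] S' ⊗[S] S') w = A2 at *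
    generalize Algebra.TensorProduct.map (AlgHom.id S S')
      (includeLeft : S' →ₐ[S] S' ⊗[S] S') u = B1 at *
    generalize Algebra.TensorProduct.map (AlgHom.id S S')
      (includeLeft : S' →ₐ[S] S' ⊗[S] S') w = B2 at *
    generalize (includeRight u : S' ⊗[S] (S' ⊗[S] S')) = C1 at *
    generalize (includeRight w : S' ⊗[S] (S' ⊗[S] S')) = C2 at *
    subst hc
    calc A2 = (C1 * C2) * (B1 * B2) * A2 := by rw [a2, a3]; ring
      _ = (C1 * B1 * A2) * (C2 * B2) := by ring
      _ = _ := by rw [a1, one_mul])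
  let L := LinearMap.ker (twistDelta u)
  let L' := LinearMap.ker (twistDelta w)
  have hL : ∀ f, f ∈ L ↔ (1 : S') ⊗ₜ[S] f = u * (f ⊗ₜ 1) := fun f => by
    rw [LinearMap.mem_ker, twistDelta_apply, sub_eq_zero]
  have hL' : ∀ f, f ∈ L' ↔ (1 : S') ⊗ₜ[S] f = w * (f ⊗ₜ 1) := fun f => by
    rw [LinearMap.mem_ker, twistDelta_apply, sub_eq_zero]
  let I : Ideal S := (L * L').comap (Algebra.linearMap S S')
  have hI : I.map (algebraMap S S') = ⊤ := by
    rw [eq_top_iff, ← Ideal.mul_top ⊤]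
    nth_rw 1 [← hu]
    rw [← hw, Ideal.span_mul_span', Ideal.span_le]
    rintro _ ⟨f, hf, g, hg, rfl⟩
    have hfg : (1 : S') ⊗ₜ[S] (f * g) = (f * g) ⊗ₜ 1 := by
      have h1 : (1 : S') ⊗ₜ[S] (f * g) = (1 ⊗ₜ f) * (1 ⊗ₜ g) := by simp
      have h2 : (f * g) ⊗ₜ[S] (1 : S') = (f ⊗ₜ 1) * (g ⊗ₜ 1) := by simp
      rw [h1, h2, hf, hg]
      linear_combination (f ⊗ₜ 1) * (g ⊗ₜ 1) * huw
    obtain ⟨s, hs⟩ := mem_range_of_eq _ hfg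
    change f * g ∈ _
    rw [← hs]
    apply Ideal.mem_map_of_mem
    change algebraMap S S' s ∈ L * L'
    rw [hs]
    exact Submodule.mul_mem_mul ((hL f).2 hf) ((hL' g).2 hg)
  have hI' : I = ⊤ := by
    rw [← Ideal.comap_map_eq_self_of_faithfullyFlat (B := S') I, hI, Ideal.comap_top]
  have h1 : (1 : S') ∈ L * L' := by
    have : (1 : S) ∈ I := hI' ▸ Submodule.mem_top
    simpa [I] using this
  obtain ⟨n, f, g, hf, hg, e⟩ := exists_fin_of_mem_mul h1
  refine ⟨n, f, g, e, fun i => (hL _).1 (hf i), fun i => ?_⟩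
  rw [(hL' _).1 (hg i), ← mul_assoc, huw, one_mul]
end descent

section polydescent
open Polynomial TensorProduct Algebra.TensorProduct
attribute [local instance] Polynomial.algebra

variable {R R' : Type*} [CommRing R] [CommRing R'] [Algebra R R']

lemma poly_faithfullyFlat [Module.FaithfullyFlat R R'] : Module.FaithfullyFlat R[X] R'[X] :=
  Module.FaithfullyFlat.of_linearEquiv _ _ (Algebra.IsPushout.equiv R R[X] R' R'[X]).symm.toLinearEquiv

variable (R R') in
noncomputable def tau2 : R' ⊗[R] R' →ₐ[R] R'[X] ⊗[R[X]] R'[X] :=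
  Algebra.TensorProduct.lift
    (((includeLeft : R'[X] →ₐ[R[X]] R'[X] ⊗[R[X]] R'[X]).restrictScalars R).comp CAlgHom)
    (((includeRight : R'[X] →ₐ[R[X]] R'[X] ⊗[R[X]] R'[X]).restrictScalars R).comp CAlgHom)
    (fun _ _ => Commute.all _ _)

lemma tau2_tmul (a b : R') : tau2 R R' (a ⊗ₜ b) = C a ⊗ₜ C b := by
  simp [tau2]

variable (R R') in
noncomputable def theta2 : (R' ⊗[R] R')[X] →+* R'[X] ⊗[R[X]] R'[X] :=
  eval₂RingHom (tau2 R R' : _ →+* _) (X ⊗ₜ 1)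


lemma X_tmul_one : (X : R'[X]) ⊗ₜ[R[X]] (1 : R'[X]) = 1 ⊗ₜ X := by
  have h : (X : R'[X]) = (X : R[X]) • (1 : R'[X]) := by
    rw [Algebra.smul_def]; simp
  rw [h, TensorProduct.smul_tmul]

variable (R R') in
noncomputable def psi2 : R'[X] ⊗[R[X]] R'[X] →ₐ[R[X]] (R' ⊗[R] R')[X] :=
  Algebra.TensorProduct.lift
    (⟨mapRingHom (includeLeft : R' →ₐ[R] R' ⊗[R] R'), fun r => by
      change (r.map _).map _ = r.map _
      rw [Polynomial.map_map]
      congr 1⟩)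
    (⟨mapRingHom (includeRight : R' →ₐ[R] R' ⊗[R] R'), fun r => by
      change (r.map _).map _ = r.map _
      rw [Polynomial.map_map]
      congr 1
      ext x
      simp [Algebra.TensorProduct.algebraMap_apply]⟩)
    (fun _ _ => Commute.all _ _)

lemma psi2_left (f : R'[X]) : psi2 R R' (f ⊗ₜ 1) =
    f.map (includeLeft : R' →ₐ[R] R' ⊗[R] R').toRingHom := by
  simp [psi2]

lemma psi2_right (f : R'[X]) : psi2 R R' (1 ⊗ₜ f) =
    f.map (includeRight : R' →ₐ[R] R' ⊗[R] R').toRingHom := by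
  simp [psi2]

lemma psi2_theta2 (u : (R' ⊗[R] R')[X]) : psi2 R R' (theta2 R R' u) = u := by
  have : ((psi2 R R' : _ →ₐ[R[X]] _).toRingHom).comp (theta2 R R') = RingHom.id _ := by
    apply Polynomial.ringHom_ext
    · intro a
      simp only [theta2, RingHom.comp_apply, coe_eval₂RingHom, eval₂_C, RingHom.id_apply]
      induction a with
      | zero => simp
      | add x y hx hy => rw [map_add, map_add, hx, hy, map_add]
      | tmul a b =>
        have : (C a : R'[X]) ⊗ₜ[R[X]] (C b : R'[X]) = (C a ⊗ₜ 1) * (1 ⊗ₜ C b) := by simp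
        have h2 : (a ⊗ₜ[R] b) = (a ⊗ₜ 1) * (1 ⊗ₜ b) := by simp
        change psi2 R R' (tau2 R R' _) = _
        rw [tau2_tmul, this, map_mul, psi2_left, psi2_right, h2, map_mul]
        simp
    · simp only [theta2, RingHom.comp_apply, coe_eval₂RingHom, eval₂_X, RingHom.id_apply]
      change psi2 R R' _ = _
      rw [psi2_left]; simp
  exact congrArg (fun f : (R' ⊗[R] R')[X] →+* (R' ⊗[R] R')[X] => f u) this

variable (R R') in
noncomputable def tau3 : (R' ⊗[R] R') ⊗[R] R' →ₐ[R] R'[X] ⊗[R[X]] (R'[X] ⊗[R[X]] R'[X]) :=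
  Algebra.TensorProduct.lift
    (((Algebra.TensorProduct.map (AlgHom.id R[X] R'[X])
      (includeLeft : R'[X] →ₐ[R[X]] R'[X] ⊗[R[X]] R'[X])).restrictScalars R).comp (tau2 R R'))
    (((includeRight.comp (includeRight : R'[X] →ₐ[R[X]] R'[X] ⊗[R[X]] R'[X])).restrictScalars R).comp
      CAlgHom)
    (fun _ _ => mul_comm (G := R'[X] ⊗[R[X]] (R'[X] ⊗[R[X]] R'[X])) _ _)

lemma tau3_tmul (a b c : R') : tau3 R R' ((a ⊗ₜ b) ⊗ₜ c) = C a ⊗ₜ (C b ⊗ₜ C c) := by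
  change (Algebra.TensorProduct.map (AlgHom.id R[X] R'[X])
      (includeLeft : R'[X] →ₐ[R[X]] R'[X] ⊗[R[X]] R'[X])) (tau2 R R' (a ⊗ₜ b)) *
      ((1 : R'[X]) ⊗ₜ ((1 : R'[X]) ⊗ₜ (C c : R'[X]))) = _
  rw [tau2_tmul]
  simp

variable (R R') in
noncomputable def theta3 : ((R' ⊗[R] R') ⊗[R] R')[X] →+* R'[X] ⊗[R[X]] (R'[X] ⊗[R[X]] R'[X]) :=
  eval₂RingHom (S := R'[X] ⊗[R[X]] (R'[X] ⊗[R[X]] R'[X])) (tau3 R R').toRingHom (X ⊗ₜ 1)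

lemma theta_compat (F : R'[X] ⊗[R[X]] R'[X] →ₐ[R[X]] R'[X] ⊗[R[X]] (R'[X] ⊗[R[X]] R'[X]))
    (G : R' ⊗[R] R' →ₐ[R] (R' ⊗[R] R') ⊗[R] R')
    (hX : F (X ⊗ₜ 1) = X ⊗ₜ 1) (hC : ∀ a b, F (C a ⊗ₜ C b) = tau3 R R' (G (a ⊗ₜ b)))
    (u : (R' ⊗[R] R')[X]) : F (theta2 R R' u) = theta3 R R' (u.map G.toRingHom) := by
  have : (F.toRingHom).comp (theta2 R R') = (theta3 R R').comp (mapRingHom G.toRingHom) := by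
    apply Polynomial.ringHom_ext
    · intro a
      simp only [theta2, theta3, RingHom.comp_apply, coe_eval₂RingHom, eval₂_C, coe_mapRingHom,
        Polynomial.map_C]
      change F (tau2 R R' a) = tau3 R R' (G a)
      induction a with
      | zero => simp
      | add x y hx hy => rw [map_add, map_add, hx, hy, map_add, map_add]
      | tmul a b => rw [tau2_tmul, hC]
    · simp only [theta2, theta3, RingHom.comp_apply, coe_eval₂RingHom, eval₂_X, coe_mapRingHom,
        Polynomial.map_X]
      exact hX
  exact congrArg (fun f : (R' ⊗[R] R')[X] →+* _ => f u) this

theorem poly_descent [Module.FaithfullyFlat R R'] (u w : (R' ⊗[R] R')[X]) (huw : u * w = 1)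
    (hc : u.map (Algebra.TensorProduct.map (includeLeft : R' →ₐ[R] R' ⊗[R] R')
        (AlgHom.id R R')).toRingHom =
      u.map (Algebra.TensorProduct.map (includeRight : R' →ₐ[R] R' ⊗[R] R')
        (AlgHom.id R R')).toRingHom *
      u.map (includeLeft : R' ⊗[R] R' →ₐ[R] (R' ⊗[R] R') ⊗[R] R').toRingHom) :
    ∃ (n : ℕ) (f g : Fin n → R'[X]), ∑ i, f i * g i = 1 ∧
      (∀ i, (f i).map (includeRight : R' →ₐ[R] R' ⊗[R] R').toRingHom =
        u * (f i).map (includeLeft : R' →ₐ[R] R' ⊗[R] R').toRingHom) ∧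
      (∀ i, u * (g i).map (includeRight : R' →ₐ[R] R' ⊗[R] R').toRingHom =
        (g i).map (includeLeft : R' →ₐ[R] R' ⊗[R] R').toRingHom) := by
  have := poly_faithfullyFlat (R := R) (R' := R')
  obtain ⟨n, f, g, h1, h2, h3⟩ := descent_unit (theta2 R R' u) (theta2 R R' w)
    (by rw [← map_mul, huw, map_one]) (by
      rw [theta_compat _ (Algebra.TensorProduct.map (includeLeft : R' →ₐ[R] R' ⊗[R] R')
        (AlgHom.id R R')) (by simp [← Algebra.TensorProduct.one_def]) (by simp [tau3_tmul]),
        theta_compat _ (Algebra.TensorProduct.map (includeRight : R' →ₐ[R] R' ⊗[R] R')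
        (AlgHom.id R R')) ?_ (by simp [tau3_tmul]), hc, map_mul,
        theta_compat _ (includeLeft : R' ⊗[R] R' →ₐ[R] (R' ⊗[R] R') ⊗[R] R')
        (by simp [← Algebra.TensorProduct.one_def])
        (by intro a b; simp only [includeLeft_apply, tau3_tmul]; simp)]
      have h : (X : R'[X]) = (X : R[X]) • (1 : R'[X]) := by
        rw [Algebra.smul_def]; simp
      simp only [includeRight_apply]
      rw [h, ← TensorProduct.smul_tmul', TensorProduct.tmul_smul, ← TensorProduct.smul_tmul']
      rfl)
  refine ⟨n, f, g, h1, fun i => ?_, fun i => ?_⟩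
  · have := congrArg (psi2 R R') (h2 i)
    rwa [map_mul, psi2_left, psi2_right, psi2_theta2] at this
  · have := congrArg (psi2 R R') (h3 i)
    rwa [map_mul, psi2_left, psi2_right, psi2_theta2] at this

end polydescent

end stageB


section stageC
open Polynomial TensorProduct Algebra.TensorProduct

/-- the `p^N`-power map as ring hom when `p = 0`. -/
def powHom (p : ℕ) [Fact p.Prime] (S : Type*) [CommRing S] (h : (p : S) = 0) (N : ℕ) : S →+* S where
  toFun x := x ^ (p ^ N)
  map_one' := one_pow _
  map_mul' x y := mul_pow x y _
  map_zero' := zero_pow (pow_pos (Fact.out : p.Prime).pos N).ne'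
  map_add' x y := by
    obtain ⟨r, hr⟩ := exists_add_pow_prime_pow_eq (Fact.out : p.Prime) x y N
    rw [hr, h]; ring

lemma powHom_apply (p : ℕ) [Fact p.Prime] (S : Type*) [CommRing S] (h : (p : S) = 0) (N : ℕ)
    (x : S) : powHom p S h N x = x ^ (p ^ N) := rfl

lemma poly_lift_of_coeff {A B : Type*} [CommRing A] [CommRing B] (φ : A →+* B) (f : B[X])
    (h : ∀ j, ∃ a, φ a = f.coeff j) : ∃ g : A[X], g.map φ = f := by
  have : f ∈ Polynomial.lifts φ := by
    rw [Polynomial.lifts_iff_coeff_lifts]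
    exact h
  exact (Polynomial.mem_lifts _).1 this

lemma poly_lift_of_eq {S S' : Type*} [CommRing S] [CommRing S'] [Algebra S S']
    [Module.FaithfullyFlat S S'] (f : S'[X])
    (h : f.map (includeRight : S' →ₐ[S] S' ⊗[S] S').toRingHom =
      f.map (includeLeft : S' →ₐ[S] S' ⊗[S] S').toRingHom) :
    ∃ g : S[X], g.map (algebraMap S S') = f := by
  apply poly_lift_of_coeff
  intro j
  apply mem_range_of_eq
  have := congrArg (fun g => g.coeff j) h
  simpa using this

lemma seminormal_pow (p : ℕ) [Fact p.Prime] {T : Type*} [CommRing T] (h : IsSeminormalRing T)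
    (hT : (p : T) = 0) (N : ℕ) {x : T} (h2 : x ^ 2 ∈ (powHom p T hT N).range)
    (h3 : x ^ 3 ∈ (powHom p T hT N).range) : x ∈ (powHom p T hT N).range := by
  obtain ⟨hred, hs⟩ := h
  obtain ⟨y, hy⟩ := h2
  obtain ⟨z, hz⟩ := h3
  have hinj : Function.Injective (powHom p T hT N) := by
    rw [injective_iff_map_eq_zero]
    intro a ha
    exact pow_eq_zero_iff (pow_pos (Fact.out : p.Prime).pos N).ne' |>.1 ha
  have hyz : y ^ 3 = z ^ 2 := by
    apply hinj
    rw [map_pow, map_pow, hy, hz]; ring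
  obtain ⟨s, hs2, hs3⟩ := hs y z hyz
  refine ⟨s, ?_⟩
  set w := powHom p T hT N s with hw
  have e2 : w ^ 2 = x ^ 2 := by rw [hw, ← map_pow, hs2, hy]
  have e3 : w ^ 3 = x ^ 3 := by rw [hw, ← map_pow, hs3, hz]
  have : (w - x) ^ 3 = 0 := by
    linear_combination 4 * e3 - 3 * x * e2 - 3 * w * e2
  exact sub_eq_zero.1 (pow_eq_zero_iff (by norm_num) |>.1 this)

variable {R R' : Type*} [CommRing R] [CommRing R'] [Algebra R R']

variable (R R') in
abbrev TT := R ⧸ nilradical R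
variable (R R') in
abbrev RT := (R ⧸ nilradical R) ⊗[R] R'

variable (R R') in
noncomputable def kap : R' →ₐ[R] RT R R' := includeRight

variable (R R') in
noncomputable def kap2 : R' ⊗[R] R' →ₐ[R] RT R R' ⊗[TT R] RT R R' :=
  Algebra.TensorProduct.lift
    (((includeLeft : RT R R' →ₐ[TT R] RT R R' ⊗[TT R] RT R R').restrictScalars R).comp (kap R R'))
    (((includeRight : RT R R' →ₐ[TT R] RT R R' ⊗[TT R] RT R R').restrictScalars R).comp (kap R R'))
    (fun _ _ => mul_comm (G := RT R R' ⊗[TT R] RT R R') _ _)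

lemma kap2_left (a : R') : kap2 R R' (a ⊗ₜ 1) = (kap R R' a) ⊗ₜ 1 := by
  change ((kap R R' a) ⊗ₜ[TT R] (1 : RT R R')) * ((1 : RT R R') ⊗ₜ[TT R] (kap R R' 1)) = _
  simp
lemma kap2_right (a : R') : kap2 R R' (1 ⊗ₜ a) = 1 ⊗ₜ (kap R R' a) := by
  change ((kap R R' 1) ⊗ₜ[TT R] (1 : RT R R')) * ((1 : RT R R') ⊗ₜ[TT R] (kap R R' a)) = _
  simp

lemma powHom_comm (p : ℕ) [Fact p.Prime] {A B : Type*} [CommRing A] [CommRing B]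
    (hA : (p : A) = 0) (hB : (p : B) = 0) (N : ℕ) (h : A →+* B) :
    (powHom p B hB N).comp h = h.comp (powHom p A hA N) := by
  ext x; simp [powHom_apply]

/-- lifting step, abstracted. -/
lemma lift_step (p : ℕ) [Fact p.Prime] {T S : Type*} [CommRing T] [CommRing S] [Algebra T S]
    [Module.FaithfullyFlat T S] (hS : (p : S) = 0) (hSS : (p : S ⊗[T] S) = 0) (N : ℕ)
    (U : (S ⊗[T] S)[X]) (hU : U.map (powHom p _ hSS N) = 1) (f : S[X])
    (hf : f.map (includeRight : S →ₐ[T] S ⊗[T] S).toRingHom =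
      U * f.map (includeLeft : S →ₐ[T] S ⊗[T] S).toRingHom ∨
      U * f.map (includeRight : S →ₐ[T] S ⊗[T] S).toRingHom =
      f.map (includeLeft : S →ₐ[T] S ⊗[T] S).toRingHom) :
    ∃ a : T[X], a.map (algebraMap T S) = f.map (powHom p S hS N) := by
  apply poly_lift_of_eq
  rw [Polynomial.map_map, Polynomial.map_map, ← powHom_comm p hS hSS, ← powHom_comm p hS hSS,
    ← Polynomial.map_map, ← Polynomial.map_map]
  rcases hf with hf | hf
  · rw [hf, Polynomial.map_mul, hU, one_mul]
  · rw [← hf, Polynomial.map_mul, hU, one_mul]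

lemma core (p : ℕ) [Fact p.Prime] {R R' T S : Type*} [CommRing R] [CommRing R'] [Algebra R R']
    [CommRing T] [CommRing S] [Algebra T S] [Module.FaithfullyFlat R R']
    [Module.FaithfullyFlat T S] (π : R →+* T) (hπ : Function.Surjective π)
    (hker : ∀ r, π r = 0 → IsNilpotent r)
    (k : R' →+* S) (hk : ∀ r, k (algebraMap R R' r) = algebraMap T S (π r))
    (k2 : R' ⊗[R] R' →+* S ⊗[T] S) (hk2l : ∀ a, k2 (a ⊗ₜ 1) = k a ⊗ₜ 1)
    (hk2r : ∀ a, k2 (1 ⊗ₜ a) = 1 ⊗ₜ k a) (hT : (p : T) = 0) (hsn : IsSeminormalRing T)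
    (u : (R' ⊗[R] R')[X]) (h0 : u.coeff 0 = 1)
    (hn : ∀ n, 1 ≤ n → IsNilpotent (u.coeff n)) (n : ℕ) (f g : Fin n → R'[X])
    (hfg : ∑ i, f i * g i = 1)
    (hf : ∀ i, (f i).map (includeRight : R' →ₐ[R] R' ⊗[R] R').toRingHom =
      u * (f i).map (includeLeft : R' →ₐ[R] R' ⊗[R] R').toRingHom)
    (hg : ∀ i, u * (g i).map (includeRight : R' →ₐ[R] R' ⊗[R] R').toRingHom =
      (g i).map (includeLeft : R' →ₐ[R] R' ⊗[R] R').toRingHom) :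
    ∃ v v' : R'[X], v * v' = 1 ∧ v.coeff 0 = 1 ∧
      v.map (includeRight : R' →ₐ[R] R' ⊗[R] R').toRingHom =
      u * v.map (includeLeft : R' →ₐ[R] R' ⊗[R] R').toRingHom := by
  classical
  set iR := (includeRight : R' →ₐ[R] R' ⊗[R] R').toRingHom with hiR
  set iL := (includeLeft : R' →ₐ[R] R' ⊗[R] R').toRingHom with hiL
  have hS : (p : S) = 0 := by
    rw [← map_natCast (algebraMap T S), hT, map_zero]
  have hSS : (p : S ⊗[T] S) = 0 := by
    rw [← map_natCast (algebraMap T (S ⊗[T] S)), hT, map_zero]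
  have hppos : 0 < p := (Fact.out : p.Prime).pos
  -- choose N
  obtain ⟨N, hN⟩ : ∃ N, ∀ n, 1 ≤ n → (u.coeff n) ^ (p ^ N) = 0 := by
    choose! e he using hn
    refine ⟨∑ i ∈ u.support, e i, fun n hn1 => ?_⟩
    by_cases hns : n ∈ u.support
    · have h1 : e n ≤ ∑ i ∈ u.support, e i :=
        Finset.single_le_sum (f := e) (fun _ _ => Nat.zero_le _) hns
      have h2 := (Nat.lt_pow_self (Fact.out : p.Prime).one_lt (n := ∑ i ∈ u.support, e i))
      exact pow_eq_zero_of_le (h1.trans h2.le) (he n hn1)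
    · rw [Polynomial.notMem_support_iff.1 hns, zero_pow (pow_pos hppos _).ne']
  set φT := powHom p T hT N with hφT
  set φS := powHom p S hS N with hφS
  have hφTS : φS.comp (algebraMap T S) = (algebraMap T S).comp φT := powHom_comm p hT hS N _
  have hTinj : Function.Injective (algebraMap T S) := FaithfulSMul.algebraMap_injective T S
  have hred : IsReduced T := hsn.1
  have hφinj : Function.Injective φT := by
    rw [injective_iff_map_eq_zero]
    intro a ha
    exact pow_eq_zero_iff (pow_pos hppos N).ne' |>.1 ha
  have hU : (u.map k2).map (powHom p _ hSS N) = 1 := by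
    ext m
    rw [Polynomial.coeff_map, Polynomial.coeff_map, powHom_apply, ← map_pow]
    rcases m with _ | m
    · simp [h0]
    · rw [hN _ (by omega)]; simp [Polynomial.coeff_one]
  have hkl : ∀ f : R'[X], (f.map iL).map k2 =
      (f.map k).map (includeLeft : S →ₐ[T] S ⊗[T] S).toRingHom := by
    intro f; ext m; simp [hiL, hk2l]
  have hkr : ∀ f : R'[X], (f.map iR).map k2 =
      (f.map k).map (includeRight : S →ₐ[T] S ⊗[T] S).toRingHom := by
    intro f; ext m; simp [hiR, hk2r]
  have ha : ∀ i, ∃ a : T[X], a.map (algebraMap T S) = ((f i).map k).map φS := fun i =>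
    lift_step p hS hSS N (u.map k2) hU _ (Or.inl (by
      rw [← hkl, ← hkr, hf, Polynomial.map_mul]))
  have hb : ∀ i, ∃ a : T[X], a.map (algebraMap T S) = ((g i).map k).map φS := fun i =>
    lift_step p hS hSS N (u.map k2) hU _ (Or.inr (by
      rw [← hkl, ← hkr, ← hg, Polynomial.map_mul]))
  choose a ha using ha
  choose b hb using hb
  have hm : ∀ i j, ∃ m : R[X], m.map (algebraMap R R') = f i * g j := by
    intro i j
    apply poly_lift_of_eq
    rw [Polynomial.map_mul, Polynomial.map_mul, hf]
    rw [mul_assoc, mul_left_comm, hg]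
  choose m hm using hm
  have hkm : ∀ q : R[X], (q.map (algebraMap R R')).map k = (q.map π).map (algebraMap T S) := by
    intro q; ext j; simp [hk]
  have hφm : ∀ q : T[X], (q.map (algebraMap T S)).map φS = (q.map φT).map (algebraMap T S) := by
    intro q; rw [Polynomial.map_map, Polynomial.map_map, hφTS]
  have hTSinj := Polynomial.map_injective (algebraMap T S) hTinj
  have hab : ∀ i j, a i * b j = ((m i j).map π).map φT := by
    intro i j
    apply hTSinj
    rw [Polynomial.map_mul, ha, hb, ← Polynomial.map_mul, ← Polynomial.map_mul, ← hm, hkm, hφm]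
  have hsum : ∑ i, a i * b i = 1 := by
    apply hTSinj
    rw [Polynomial.map_sum]
    simp only [Polynomial.map_mul, ha, hb]
    simp only [← Polynomial.map_mul, ← Polynomial.map_sum, hfg, Polynomial.map_one]
  have hzero : ∀ (q : R'[X]) (c : T[X]), c.map (algebraMap T S) = (q.map k).map φS →
      iR (q.coeff 0) = iL (q.coeff 0) → c.coeff 0 ∈ φT.range := by
    intro q c hc hq
    obtain ⟨r, hr⟩ := mem_range_of_eq (S := R) (q.coeff 0) hq
    refine ⟨π r, hTinj ?_⟩
    have := congrArg (fun z => z.coeff 0) hc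
    simp only [Polynomial.coeff_map] at this
    rw [this, ← hr, hk]
    exact (congrArg (fun z => z (π r)) hφTS).symm
  have hcoef := traverso φT.range (p ^ N) (pow_pos hppos N) (fun x => ⟨x, rfl⟩)
    (fun x h2 h3 => seminormal_pow p hsn hT N h2 h3) a b
    (fun i j l => ⟨((m i j).map π).coeff l, by rw [hab, Polynomial.coeff_map (f := φT)]⟩) hsum
    (fun i => hzero (f i) (a i) (ha i) (by
      have := congrArg (fun z => z.coeff 0) (hf i)
      simpa [Polynomial.mul_coeff_zero, h0] using this))
    (fun i => hzero (g i) (b i) (hb i) (by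
      have := congrArg (fun z => z.coeff 0) (hg i)
      simpa [Polynomial.mul_coeff_zero, h0] using this))
  have hα : ∀ i, ∃ α : R[X], (α.map π).map φT = a i := by
    intro i
    obtain ⟨α, h⟩ := poly_lift_of_coeff φT (a i) (hcoef.1 i)
    obtain ⟨α', h'⟩ := Polynomial.map_surjective π hπ α
    exact ⟨α', by rw [h', h]⟩
  have hβ : ∀ i, ∃ α : R[X], (α.map π).map φT = b i := by
    intro i
    obtain ⟨α, h⟩ := poly_lift_of_coeff φT (b i) (hcoef.2 i)
    obtain ⟨α', h'⟩ := Polynomial.map_surjective π hπ α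
    exact ⟨α', by rw [h', h]⟩
  choose α hα using hα
  choose β hβ using hβ
  set ι := algebraMap R R' with hι
  set v : R'[X] := ∑ i, f i * (β i).map ι with hv
  set v' : R'[X] := ∑ j, g j * (α j).map ι with hv'
  set w0 : R[X] := ∑ i, ∑ j, m i j * (β i * α j) with hw0
  have hvv : v * v' = w0.map ι := by
    rw [hv, hv', Finset.sum_mul_sum, hw0, Polynomial.map_sum]
    refine Finset.sum_congr rfl fun i _ => ?_
    rw [Polynomial.map_sum]
    refine Finset.sum_congr rfl fun j _ => ?_
    rw [Polynomial.map_mul, Polynomial.map_mul, hm]; ring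
  have hw1 : (w0.map π) = 1 := by
    apply Polynomial.map_injective φT hφinj
    rw [hw0]
    simp only [Polynomial.map_sum, Polynomial.map_mul, hα, hβ, ← hab, Polynomial.map_one]
    calc _ = (∑ i, a i * b i) * (∑ j, a j * b j) := by
          rw [Finset.sum_mul_sum]
          exact Finset.sum_congr rfl fun i _ => Finset.sum_congr rfl fun j _ => by ring
      _ = 1 := by rw [hsum, one_mul]
  have hunit : IsUnit w0 := by
    have : IsNilpotent (w0 - 1) := by
      rw [Polynomial.isNilpotent_iff]
      intro j
      apply hker
      have := congrArg (fun z => z.coeff j) hw1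
      simp only [Polynomial.coeff_map] at this
      rw [Polynomial.coeff_sub, map_sub, this, ← Polynomial.coeff_map, Polynomial.map_one, sub_self]
    simpa using this.isUnit_one_add
  have hvu : IsUnit v := by
    apply isUnit_of_mul_isUnit_left (y := v')
    rw [hvv]
    exact hunit.map (Polynomial.mapRingHom ι)
  have hιLR : ∀ q : R[X], (q.map ι).map iR = (q.map ι).map iL := by
    intro q; ext j
    simp only [Polynomial.coeff_map]
    exact (includeRight : R' →ₐ[R] R' ⊗[R] R').commutes _ |>.trans
      ((includeLeft : R' →ₐ[R] R' ⊗[R] R').commutes _).symm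
  have hvc : v.map iR = u * v.map iL := by
    rw [hv, Polynomial.map_sum, Polynomial.map_sum, Finset.mul_sum]
    refine Finset.sum_congr rfl fun i _ => ?_
    rw [Polynomial.map_mul, Polynomial.map_mul, hf, hιLR, mul_assoc]
  have hv0 : IsUnit (v.coeff 0) := by
    have := hvu.map (Polynomial.constantCoeff)
    simpa using this
  obtain ⟨c, hc⟩ := hv0.exists_right_inv
  have hv0c : iR (v.coeff 0) = iL (v.coeff 0) := by
    have := congrArg (fun z => z.coeff 0) hvc
    simpa [Polynomial.mul_coeff_zero, h0] using this
  have hcc : iR c = iL c := by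
    have h1 : iR (v.coeff 0) * iR c = 1 := by rw [← map_mul, hc, map_one]
    have h2 : iL (v.coeff 0) * iL c = 1 := by rw [← map_mul, hc, map_one]
    rw [hv0c] at h1
    calc iR c = (iL (v.coeff 0) * iL c) * iR c := by rw [h2, one_mul]
      _ = (iL (v.coeff 0) * iR c) * iL c := by ring
      _ = iL c := by rw [h1, one_mul]
  obtain ⟨z, hz⟩ := hvu.exists_right_inv
  refine ⟨C c * v, C (v.coeff 0) * z, ?_, ?_, ?_⟩
  · calc C c * v * (C (v.coeff 0) * z) = (C (v.coeff 0) * C c) * (v * z) := by ring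
      _ = 1 := by rw [hz, ← C_mul, hc]; simp
  · rw [Polynomial.coeff_C_mul, mul_comm, hc]
  · rw [Polynomial.map_mul, Polynomial.map_mul, hvc, Polynomial.map_C, Polynomial.map_C, hcc]
    ring

theorem unit_coboundary (p : ℕ) [Fact p.Prime] {R R' : Type*} [CommRing R] [CommRing R']
    [Algebra R R'] [Module.FaithfullyFlat R R'] (hp : IsNilpotent (p : R))
    (hsn : IsSeminormalRing (R ⧸ nilradical R))
    (u w : (R' ⊗[R] R')[X]) (huw : u * w = 1) (h0 : u.coeff 0 = 1)
    (hn : ∀ n, 1 ≤ n → IsNilpotent (u.coeff n))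
    (hc : u.map (Algebra.TensorProduct.map (includeLeft : R' →ₐ[R] R' ⊗[R] R')
        (AlgHom.id R R')).toRingHom =
      u.map (Algebra.TensorProduct.map (includeRight : R' →ₐ[R] R' ⊗[R] R')
        (AlgHom.id R R')).toRingHom *
      u.map (includeLeft : R' ⊗[R] R' →ₐ[R] (R' ⊗[R] R') ⊗[R] R').toRingHom) :
    ∃ v v' : R'[X], v * v' = 1 ∧ v.coeff 0 = 1 ∧
      v.map (includeRight : R' →ₐ[R] R' ⊗[R] R').toRingHom =
      u * v.map (includeLeft : R' →ₐ[R] R' ⊗[R] R').toRingHom := by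
  obtain ⟨n, f, g, hfg, hf, hg⟩ := poly_descent u w huw hc
  refine core p (T := TT R) (S := RT R R') (Ideal.Quotient.mk _) Ideal.Quotient.mk_surjective
    (fun r hr => ?_) (kap R R').toRingHom (fun r => ?_) (kap2 R R').toRingHom kap2_left kap2_right
    ?_ hsn u h0 hn n f g hfg hf hg
  · exact mem_nilradical.1 (Ideal.Quotient.eq_zero_iff_mem.1 hr)
  · exact (kap R R').commutes r
  · rw [← map_natCast (Ideal.Quotient.mk (nilradical R))]
    exact Ideal.Quotient.eq_zero_iff_mem.2 (mem_nilradical.2 hp)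
end stageC

section artinHasse
open PowerSeries

/-- `X d/dX`. -/
noncomputable def theta {S : Type*} [CommRing S] (f : S⟦X⟧) : S⟦X⟧ := X * d⁄dX S f

lemma coeff_theta {S : Type*} [CommRing S] (f : S⟦X⟧) (n : ℕ) :
    coeff n (theta f) = n * coeff n f := by
  rcases n with _ | n
  · simp [theta]
  · rw [theta, coeff_succ_X_mul, coeff_derivative]; push_cast; ring

lemma theta_mul {S : Type*} [CommRing S] (f g : S⟦X⟧) :
    theta (f * g) = theta f * g + f * theta g := by
  simp only [theta, Derivation.leibniz, smul_eq_mul]; ring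

lemma theta_pow {S : Type*} [CommRing S] (f : S⟦X⟧) (n : ℕ) (g : S⟦X⟧) (h : theta f = f * g) :
    theta (f ^ n) = f ^ n * (n * g) := by
  induction n with
  | zero => ext m; rw [coeff_theta]; rcases m with _ | m <;> simp [coeff_one]
  | succ n ih => rw [pow_succ, theta_mul, ih, h]; push_cast; ring

lemma theta_expand {S : Type*} [CommRing S] (m : ℕ) (hm : m ≠ 0) (f : S⟦X⟧) :
    theta (expand m hm f) = m * expand m hm (theta f) := by
  ext n
  rw [coeff_theta, ← map_natCast (C (R := S)), coeff_C_mul, coeff_expand, coeff_expand]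
  split_ifs with h
  · obtain ⟨k, rfl⟩ := h
    rw [Nat.mul_div_cancel_left _ (Nat.pos_of_ne_zero hm), coeff_theta]; push_cast; ring
  · simp

lemma theta_rescale {S : Type*} [CommRing S] (c : S) (f : S⟦X⟧) :
    theta (rescale c f) = rescale c (theta f) := by
  ext n; simp only [coeff_theta, coeff_rescale]; ring

lemma theta_map {S S' : Type*} [CommRing S] [CommRing S'] (φ : S →+* S') (f : S⟦X⟧) :
    theta (map φ f) = map φ (theta f) := by
  ext n; simp [coeff_theta]

/-- uniqueness for `θ f = f a`. -/
lemma theta_unique {S : Type*} [CommRing S] (hS : ∀ (n : ℕ) (s : S), n ≠ 0 → (n : S) * s = 0 → s = 0)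
    (M : ℕ) (f g a b : S⟦X⟧) (hf : theta f = f * a) (hg : theta g = g * b)
    (hab : ∀ n < M, coeff n a = coeff n b) (ha0 : coeff 0 a = 0)
    (hfg : coeff 0 f = coeff 0 g) : ∀ n < M, coeff n f = coeff n g := by
  intro n
  induction n using Nat.strong_induction_on with
  | _ n ih =>
    intro hn
    rcases Nat.eq_zero_or_pos n with rfl | hpos
    · exact hfg
    apply sub_eq_zero.1
    apply hS n _ hpos.ne'
    rw [mul_sub, ← coeff_theta, ← coeff_theta, hf, hg, coeff_mul, coeff_mul, ← Finset.sum_sub_distrib]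
    apply Finset.sum_eq_zero
    rintro ⟨i, j⟩ hij
    rw [Finset.HasAntidiagonal.mem_antidiagonal] at hij
    simp only at hij ⊢
    rw [hab j (by omega)]
    rcases Nat.eq_zero_or_pos j with rfl | hj
    · rw [← hab 0 (by omega), ha0]; ring
    · rw [ih i (by omega) (by omega)]; ring

/-- existence over fields of characteristic zero. -/
noncomputable def odeSol {K : Type*} [Field K] (g : ℕ → K) : ℕ → K
  | 0 => 1
  | n + 1 => ((n + 1 : ℕ) : K)⁻¹ * ∑ i : Fin (n + 1), odeSol g i * g (n + 1 - i)

lemma odeSol_spec {K : Type*} [Field K] [CharZero K] (g : K⟦X⟧) (hg : coeff 0 g = 0) :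
    theta (PowerSeries.mk (odeSol (fun n => coeff n g))) =
      PowerSeries.mk (odeSol (fun n => coeff n g)) * g := by
  ext n
  rw [coeff_theta, coeff_mk, coeff_mul, Finset.Nat.sum_antidiagonal_eq_sum_range_succ_mk,
    Finset.sum_range_succ]
  simp only [Nat.sub_self, hg, mul_zero, add_zero, coeff_mk]
  rcases n with _ | n
  · simp
  · rw [odeSol, ← mul_assoc, mul_inv_cancel₀ (Nat.cast_ne_zero.2 (Nat.succ_ne_zero n)), one_mul]
    rw [Finset.sum_range]

open Classical in
/-- `∑ t^{p^k}`. -/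
noncomputable def ell (p : ℕ) (S : Type*) [CommRing S] : S⟦X⟧ :=
  PowerSeries.mk fun n => if ∃ k, n = p ^ k then 1 else 0

lemma coeff_ell (p : ℕ) (S : Type*) [CommRing S] (n : ℕ) [Decidable (∃ k, n = p ^ k)] :
    coeff n (ell p S) = if ∃ k, n = p ^ k then 1 else 0 := by
  rw [ell, coeff_mk]; congr

variable (p : ℕ) [hpf : Fact p.Prime]

lemma coeff_zero_ell (S : Type*) [CommRing S] : coeff 0 (ell p S) = 0 := by
  classical
  rw [coeff_ell, if_neg]
  rintro ⟨k, hk⟩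
  exact (pow_pos hpf.out.pos k).ne hk

lemma ell_expand (S : Type*) [CommRing S] :
    ell p S = expand p hpf.out.ne_zero (ell p S) + X := by
  classical
  ext n
  rw [map_add, coeff_expand, coeff_ell, coeff_X]
  by_cases h1 : n = 1
  · subst h1
    rw [if_pos ⟨0, by simp⟩, if_neg (by simpa using hpf.out.one_lt.ne'), if_pos rfl, zero_add]
  · rw [if_neg h1, add_zero]
    by_cases hpn : p ∣ n
    · rw [if_pos hpn, coeff_ell]
      obtain ⟨m, rfl⟩ := hpn
      rw [Nat.mul_div_cancel_left _ hpf.out.pos]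
      congr 1
      apply propext
      constructor
      · rintro ⟨k, hk⟩
        rcases k with _ | k
        · exact absurd (by simpa using hk) h1
        · refine ⟨k, Nat.eq_of_mul_eq_mul_left hpf.out.pos ?_⟩
          rw [hk]; ring
      · rintro ⟨k, rfl⟩; exact ⟨k + 1, by ring⟩
    · rw [if_neg hpn, if_neg]
      rintro ⟨k, rfl⟩
      rcases k with _ | k
      · simp at h1
      · exact hpn (dvd_pow_self p (Nat.succ_ne_zero k))

/-- `exp(pt)`. -/
noncomputable def expp : ℚ_[p]⟦X⟧ := PowerSeries.mk fun n => (p : ℚ_[p]) ^ n / (n.factorial : ℚ_[p])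

lemma theta_expp : theta (expp p) = expp p * ((p : ℚ_[p]⟦X⟧) * X) := by
  ext n
  rw [coeff_theta, ← mul_assoc, expp, coeff_mk]
  rcases n with _ | n
  · simp
  · rw [coeff_succ_mul_X, ← map_natCast (C (R := ℚ_[p])), coeff_mul_C, coeff_mk, Nat.factorial_succ]
    have : (n.factorial : ℚ_[p]) ≠ 0 := Nat.cast_ne_zero.2 n.factorial_ne_zero
    have : ((n + 1 : ℕ) : ℚ_[p]) ≠ 0 := Nat.cast_ne_zero.2 n.succ_ne_zero
    push_cast at *
    field_simp
    ring

/-- multiples of `p` in `ℤ_p` inside `ℚ_p`. -/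
noncomputable def pz : AddSubgroup ℚ_[p] :=
  ((AddMonoidHom.mulLeft (p : ℚ_[p])).comp (PadicInt.Coe.ringHom (p := p)).toAddMonoidHom).range

lemma mem_pz {x : ℚ_[p]} : x ∈ pz p ↔ ∃ z : ℤ_[p], (p : ℚ_[p]) * z = x := Iff.rfl

lemma expp_mem (n : ℕ) (hn : n ≠ 0) : coeff n (expp p) ∈ pz p := by
  rw [expp, coeff_mk]
  have hlt := padicValNat_factorial_lt_of_ne_zero (p := p) hn
  obtain ⟨m, hm⟩ := pow_padicValNat_dvd (p := p) (n := n.factorial)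
  set v := padicValNat p n.factorial
  have hmp : ¬ p ∣ m := by
    rintro ⟨r, rfl⟩
    have : p ^ (v + 1) ∣ n.factorial := ⟨r, by rw [hm]; ring⟩
    exact pow_succ_padicValNat_not_dvd n.factorial_ne_zero this
  have hmu : IsUnit (m : ℤ_[p]) := by
    rw [PadicInt.isUnit_iff]
    have := PadicInt.norm_int_lt_one_iff_dvd (p := p) (m : ℤ)
    have h2 := PadicInt.norm_le_one (m : ℤ_[p])
    by_contra hne
    have h3 : ‖((m : ℤ) : ℤ_[p])‖ < 1 := by push_cast; exact lt_of_le_of_ne h2 hne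
    exact hmp (Int.natCast_dvd_natCast.1 (this.1 h3))
  obtain ⟨w, hw⟩ := hmu.exists_right_inv
  refine (mem_pz p).2 ⟨(p : ℤ_[p]) ^ (n - 1 - v) * w, ?_⟩
  have hw' : (m : ℚ_[p]) * (w : ℚ_[p]) = 1 := by exact_mod_cast congrArg (fun z : ℤ_[p] => (z : ℚ_[p])) hw
  have hp0 : (p : ℚ_[p]) ≠ 0 := Nat.cast_ne_zero.2 hpf.out.ne_zero
  have hm0 : (m : ℚ_[p]) ≠ 0 := left_ne_zero_of_mul_eq_one hw'
  rw [hm]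
  push_cast
  rw [eq_div_iff (mul_ne_zero (pow_ne_zero _ hp0) hm0)]
  calc (p : ℚ_[p]) * (p ^ (n - 1 - v) * w) * (p ^ v * m)
      = (p * p ^ (n - 1 - v) * p ^ v) * (m * w) := by ring
    _ = p ^ n := by
      rw [hw', mul_one, ← pow_succ', ← pow_add]; congr 1; omega

/-- the rational Artin-Hasse series. -/
noncomputable def ahQ : ℚ_[p]⟦X⟧ :=
  PowerSeries.mk (odeSol (fun n => coeff n (ell p ℚ_[p])))

lemma theta_ahQ : theta (ahQ p) = ahQ p * ell p ℚ_[p] := odeSol_spec _ (coeff_zero_ell p _)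

lemma ahQ_zero : coeff 0 (ahQ p) = 1 := by rw [ahQ, coeff_mk, odeSol]

lemma ahQ_dwork : ahQ p ^ p = expand p hpf.out.ne_zero (ahQ p) * expp p := by
  ext n
  refine theta_unique (fun n s hn h => ?_) (n + 1) _ _ _ (theta_pow _ _ _ (theta_ahQ p))
    (b := (p : ℚ_[p]⟦X⟧) * ell p ℚ_[p]) ?_ (fun _ _ => rfl) ?_ ?_ n (Nat.lt_succ_self n)
  · exact (mul_eq_zero.1 h).resolve_left (Nat.cast_ne_zero.2 hn)
  · rw [theta_mul, theta_expand, theta_ahQ, theta_expp, map_mul]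
    conv_rhs => rw [ell_expand p]
    ring
  · rw [← map_natCast (C (R := ℚ_[p])), coeff_C_mul, coeff_zero_ell, mul_zero]
  · have h0 := ahQ_zero p
    rw [coeff_zero_eq_constantCoeff] at h0
    have h1 : constantCoeff (expp p) = 1 := by
      rw [← coeff_zero_eq_constantCoeff_apply, expp, coeff_mk]; simp
    rw [coeff_zero_eq_constantCoeff_apply, coeff_zero_eq_constantCoeff_apply, map_pow, map_mul,
      constantCoeff_expand, h1, h0, one_pow, one_mul]

lemma poly_pow_mod (A : Polynomial ℤ_[p]) (n : ℕ) :
    ∃ z : ℤ_[p], (p : ℤ_[p]) * z = (A ^ p).coeff n - if p ∣ n then A.coeff (n / p) else 0 := by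
  have h : (A ^ p).coeff n - (if p ∣ n then A.coeff (n / p) else 0) ∈
      RingHom.ker (PadicInt.toZMod (p := p)) := by
    rw [RingHom.mem_ker, map_sub, ← Polynomial.coeff_map, Polynomial.map_pow, ← ZMod.expand_card,
      Polynomial.coeff_expand hpf.out.pos]
    split_ifs <;> simp
  rw [PadicInt.ker_toZMod, PadicInt.maximalIdeal_eq_span_p, Ideal.mem_span_singleton] at h
  obtain ⟨z, hz⟩ := h
  exact ⟨z, hz.symm⟩

lemma ahQ_integral (n : ℕ) : ∃ z : ℤ_[p], (z : ℚ_[p]) = coeff n (ahQ p) := by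
  induction n using Nat.strong_induction_on with
  | _ n ih =>
    rcases Nat.eq_zero_or_pos n with rfl | hpos
    · exact ⟨1, by rw [ahQ_zero]; simp⟩
    obtain ⟨A, hA⟩ : ∃ A : Polynomial ℤ_[p], A.map (PadicInt.Coe.ringHom (p := p)) = trunc n (ahQ p) := by
      have : trunc n (ahQ p) ∈ Polynomial.lifts (PadicInt.Coe.ringHom (p := p)) := by
        rw [Polynomial.lifts_iff_coeff_lifts]
        intro j
        rw [coeff_trunc]
        split_ifs with hj
        · exact ih j hj
        · exact ⟨0, map_zero _⟩
      exact (Polynomial.mem_lifts _).1 this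
    have hAc : ∀ j < n, ((A.coeff j : ℤ_[p]) : ℚ_[p]) = coeff j (ahQ p) := by
      intro j hj
      have := congrArg (fun q => q.coeff j) hA
      simp only [Polynomial.coeff_map, coeff_trunc, if_pos hj] at this
      exact this
    obtain ⟨H, hH⟩ : (X : ℚ_[p]⟦X⟧) ^ n ∣ ahQ p - (trunc n (ahQ p) : ℚ_[p]⟦X⟧) := by
      rw [X_pow_dvd_iff]
      intro m hm
      rw [map_sub, Polynomial.coeff_coe, coeff_trunc, if_pos hm, sub_self]
    set B : ℚ_[p]⟦X⟧ := (trunc n (ahQ p) : ℚ_[p]⟦X⟧) with hB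
    have hE : ahQ p = B + X ^ n * H := by rw [← hH]; ring
    have hHn : coeff 0 H = coeff n (ahQ p) := by
      have := congrArg (coeff n) hH
      rw [map_sub, hB, Polynomial.coeff_coe, coeff_trunc, if_neg (lt_irrefl n), sub_zero] at this
      rw [this]
      simpa using (coeff_X_pow_mul H n 0).symm
    have hB0 : coeff 0 B = 1 := by
      rw [hB, Polynomial.coeff_coe, coeff_trunc, if_pos hpos, ahQ_zero]
    obtain ⟨k, hk⟩ := Polynomial.powAddExpansion B (X ^ n * H) p
    have hEp : coeff n (ahQ p ^ p) = (((A ^ p).coeff n : ℤ_[p]) : ℚ_[p]) + p * coeff n (ahQ p) := by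
      rw [hE, hk, map_add, map_add]
      have e1 : coeff n (B ^ p) = (((A ^ p).coeff n : ℤ_[p]) : ℚ_[p]) := by
        rw [hB, ← Polynomial.coe_pow, Polynomial.coeff_coe, ← hA, ← Polynomial.map_pow,
          Polynomial.coeff_map]
        rfl
      have e2 : coeff n ((p : ℚ_[p]⟦X⟧) * B ^ (p - 1) * (X ^ n * H)) = p * coeff n (ahQ p) := by
        rw [show (p : ℚ_[p]⟦X⟧) * B ^ (p - 1) * (X ^ n * H) =
          X ^ n * ((p : ℚ_[p]⟦X⟧) * B ^ (p - 1) * H) by ring]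
        have := coeff_X_pow_mul ((p : ℚ_[p]⟦X⟧) * B ^ (p - 1) * H) n 0
        rw [zero_add] at this
        rw [this]
        rw [coeff_zero_eq_constantCoeff_apply] at hB0 hHn ⊢
        rw [map_mul, map_mul, map_pow, hB0, hHn, one_pow, mul_one, map_natCast]
      have e3 : coeff n (k * (X ^ n * H) ^ 2) = 0 := by
        rw [show k * (X ^ n * H) ^ 2 = X ^ (n + n) * (k * H ^ 2) by ring, coeff_X_pow_mul', if_neg]
        omega
      rw [e1, e2, e3, add_zero, ← hE]
    -- the right-hand side
    have hR : coeff n (expand p hpf.out.ne_zero (ahQ p) * expp p) -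
        (if p ∣ n then ((A.coeff (n / p) : ℤ_[p]) : ℚ_[p]) else 0) ∈ pz p := by
      have hdiv : n / p < n := Nat.div_lt_self hpos hpf.out.one_lt
      have hn0 : coeff n (expand p hpf.out.ne_zero (ahQ p)) * coeff 0 (expp p) =
          (if p ∣ n then ((A.coeff (n / p) : ℤ_[p]) : ℚ_[p]) else 0) := by
        rw [coeff_expand, expp, coeff_mk, hAc _ hdiv]; simp
      rw [coeff_mul, Finset.Nat.sum_antidiagonal_eq_sum_range_succ_mk, Finset.sum_range_succ]
      simp only [Nat.sub_self]
      rw [hn0, add_sub_cancel_right]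
      refine AddSubgroup.sum_mem _ fun i hi => ?_
      rw [Finset.mem_range] at hi
      obtain ⟨z, hz⟩ := (mem_pz p).1 (expp_mem p (n - i) (by omega))
      rw [coeff_expand]
      split_ifs with hpi
      · obtain ⟨y, hy⟩ := ih (i / p) (lt_of_le_of_lt (Nat.div_le_self _ _) hi)
        refine (mem_pz p).2 ⟨y * z, ?_⟩
        rw [← hy, ← hz]; push_cast; ring
      · rw [zero_mul]; exact zero_mem _
    rw [← ahQ_dwork, hEp] at hR
    obtain ⟨z, hz⟩ := (mem_pz p).1 hR
    obtain ⟨y, hy⟩ := poly_pow_mod p A n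
    have hy' : (p : ℚ_[p]) * y = (((A ^ p).coeff n : ℤ_[p]) : ℚ_[p]) -
        (if p ∣ n then ((A.coeff (n / p) : ℤ_[p]) : ℚ_[p]) else 0) := by
      have := congrArg (fun z : ℤ_[p] => (z : ℚ_[p])) hy
      simp only [PadicInt.coe_mul, PadicInt.coe_natCast, PadicInt.coe_sub] at this
      rw [this]
      split_ifs <;> simp
    have hp0 : (p : ℚ_[p]) ≠ 0 := Nat.cast_ne_zero.2 hpf.out.ne_zero
    refine ⟨z - y, mul_left_cancel₀ hp0 ?_⟩
    push_cast
    linear_combination hz - hy'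

/-- The integral Artin-Hasse series. -/
theorem exists_ah : ∃ E : ℤ_[p]⟦X⟧, coeff 0 E = 1 ∧ theta E = E * ell p ℤ_[p] := by
  choose z hz using ahQ_integral p
  have hinj : Function.Injective (PadicInt.Coe.ringHom (p := p)) := Subtype.coe_injective
  have hmap : map (PadicInt.Coe.ringHom (p := p)) (PowerSeries.mk z) = ahQ p := by
    ext n; rw [coeff_map, coeff_mk]; exact hz n
  refine ⟨PowerSeries.mk z, ?_, ?_⟩
  · apply hinj
    rw [← coeff_map, hmap, ahQ_zero, map_one]
  · apply map_injective _ hinj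
    rw [← theta_map, hmap, theta_ahQ, map_mul, hmap]
    congr 1
    classical
    ext n
    rw [coeff_map, coeff_ell, coeff_ell]; split_ifs <;> simp

end artinHasse

section ahProducts
open PowerSeries

variable (p : ℕ) [hpf : Fact p.Prime]

/-- The Artin-Hasse exponential over `ℤ_p`. -/
noncomputable def ah : ℤ_[p]⟦X⟧ := (exists_ah p).choose

lemma ah_zero : coeff 0 (ah p) = 1 := (exists_ah p).choose_spec.1
lemma theta_ah : theta (ah p) = ah p * ell p ℤ_[p] := (exists_ah p).choose_spec.2

lemma ah_one : coeff 1 (ah p) = 1 := by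
  classical
  have h := congrArg (coeff 1) (theta_ah p)
  rw [coeff_theta, coeff_mul, Finset.Nat.sum_antidiagonal_eq_sum_range_succ_mk] at h
  simp only [Finset.sum_range_succ, Finset.sum_range_zero, Nat.sub_zero, Nat.sub_self, zero_add,
    ah_zero, coeff_zero_ell] at h
  rw [coeff_ell, if_pos ⟨0, by simp⟩] at h
  simpa using h

lemma map_ell {S S' : Type*} [CommRing S] [CommRing S'] (φ : S →+* S') :
    map φ (ell p S) = ell p S' := by
  classical
  ext n
  rw [coeff_map, coeff_ell, coeff_ell]; split_ifs <;> simp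

variable {p}
variable {S S' : Type*} [CommRing S] [CommRing S'] (ρ : ℤ_[p] →+* S)

/-- `E(c t^m)`. -/
noncomputable def Em (c : S) (m : ℕ) : S⟦X⟧ :=
  if h : m = 0 then 1 else expand m h (rescale c (map ρ (ah p)))

lemma Em_coeff (c : S) {m : ℕ} (hm : m ≠ 0) (n : ℕ) :
    coeff n (Em ρ c m) = if m ∣ n then c ^ (n / m) * ρ (coeff (n / m) (ah p)) else 0 := by
  rw [Em, dif_neg hm, coeff_expand, coeff_rescale, coeff_map]

lemma Em_coeff_zero (c : S) (m : ℕ) : coeff 0 (Em ρ c m) = 1 := by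
  by_cases hm : m = 0
  · rw [Em, dif_pos hm]; simp
  · rw [Em_coeff ρ c hm]; simp only [dvd_zero, if_true, Nat.zero_div, ah_zero]; simp

lemma Em_coeff_lt (c : S) {m n : ℕ} (hn : n ≠ 0) (hnm : n < m) : coeff n (Em ρ c m) = 0 := by
  rw [Em_coeff ρ c (by omega), if_neg]
  exact Nat.not_dvd_of_pos_of_lt (Nat.pos_of_ne_zero hn) hnm

lemma Em_coeff_self (c : S) {m : ℕ} (hm : m ≠ 0) : coeff m (Em ρ c m) = c := by
  rw [Em_coeff ρ c hm, if_pos dvd_rfl, Nat.div_self (Nat.pos_of_ne_zero hm), ah_one]; simp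

lemma Em_zero (m : ℕ) : Em ρ 0 m = 1 := by
  by_cases hm : m = 0
  · rw [Em, dif_pos hm]
  · ext n
    rw [Em_coeff ρ 0 hm, coeff_one]
    rcases Nat.eq_zero_or_pos n with rfl | hn
    · simp only [dvd_zero, if_true, Nat.zero_div, ah_zero]; simp
    · rw [if_neg hn.ne']
      split_ifs with h
      · obtain ⟨k, rfl⟩ := h
        have : k ≠ 0 := by rintro rfl; simp at hn
        rw [Nat.mul_div_cancel_left _ (Nat.pos_of_ne_zero hm), zero_pow this, zero_mul]
      · rfl

lemma Em_map (φ : S →+* S') (c : S) (m : ℕ) : map φ (Em ρ c m) = Em (φ.comp ρ) (φ c) m := by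
  by_cases hm : m = 0
  · rw [Em, Em, dif_pos hm, dif_pos hm, map_one]
  · ext n
    rw [coeff_map, Em_coeff ρ c hm, Em_coeff _ _ hm]
    split_ifs <;> simp

lemma theta_Em (c : S) {m : ℕ} (hm : m ≠ 0) :
    theta (Em ρ c m) = Em ρ c m * ((m : S⟦X⟧) * expand m hm (rescale c (ell p S))) := by
  rw [Em, dif_neg hm, theta_expand, theta_rescale, theta_map, theta_ah, map_mul, map_mul, map_mul,
    map_ell]
  ring

lemma theta_prod {ι : Type*} (s : Finset ι) (f g : ι → S⟦X⟧) (h : ∀ i, theta (f i) = f i * g i) :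
    theta (∏ i ∈ s, f i) = (∏ i ∈ s, f i) * ∑ i ∈ s, g i := by
  classical
  induction s using Finset.induction_on with
  | empty => ext m; rw [coeff_theta]; rcases m with _ | m <;> simp [coeff_one]
  | insert a s ha ih =>
    rw [Finset.prod_insert ha, Finset.sum_insert ha, theta_mul, ih, h]; ring

/-- `∏_{k<N} E(x_k t^{p^k})`. -/
noncomputable def JN (N : ℕ) (x : WittVector p S) : S⟦X⟧ :=
  ∏ k ∈ Finset.range N, Em ρ (x.coeff k) (p ^ k)

lemma JN_map (φ : S →+* S') (N : ℕ) (x : WittVector p S) :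
    map φ (JN ρ N x) = JN (φ.comp ρ) N (WittVector.map φ x) := by
  rw [JN, JN, map_prod]
  simp only [Em_map, WittVector.map_coeff]

lemma ppne (k : ℕ) : p ^ k ≠ 0 := (pow_pos hpf.out.pos k).ne'

/-- log-derivative. -/
noncomputable def LN (N : ℕ) (x : WittVector p S) : S⟦X⟧ :=
  ∑ k ∈ Finset.range N, ((p ^ k : ℕ) : S⟦X⟧) * expand (p ^ k) (ppne k) (rescale (x.coeff k) (ell p S))

lemma theta_JN (N : ℕ) (x : WittVector p S) : theta (JN ρ N x) = JN ρ N x * LN N x :=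
  theta_prod _ _ _ fun k => theta_Em ρ (x.coeff k) (ppne k)

lemma JN_zero (N : ℕ) (x : WittVector p S) : coeff 0 (JN ρ N x) = 1 := by
  rw [JN, coeff_zero_eq_constantCoeff_apply, map_prod]
  apply Finset.prod_eq_one
  intro k _
  rw [← coeff_zero_eq_constantCoeff_apply, Em_coeff_zero]

lemma LN_term (k n : ℕ) (c : S) :
    coeff n (((p ^ k : ℕ) : S⟦X⟧) * expand (p ^ k) (ppne k) (rescale c (ell p S))) =
      (p : S) ^ k * if p ^ k ∣ n then c ^ (n / p ^ k) * coeff (n / p ^ k) (ell p S) else 0 := by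
  rw [← map_natCast (C (R := S)), coeff_C_mul, coeff_expand, coeff_rescale]; push_cast; rfl

lemma LN_coeff_of_not (N n : ℕ) (hn : ¬ ∃ m, n = p ^ m) (x : WittVector p S) :
    coeff n (LN N x) = 0 := by
  classical
  rw [LN, map_sum]
  apply Finset.sum_eq_zero
  intro k _
  rw [LN_term]
  split_ifs with h
  · obtain ⟨j, rfl⟩ := h
    rw [Nat.mul_div_cancel_left _ (Nat.pos_of_ne_zero (ppne k)), coeff_ell, if_neg]
    · simp
    · rintro ⟨i, rfl⟩; exact hn ⟨k + i, by rw [pow_add]⟩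
  · simp

lemma LN_coeff_pow (N m : ℕ) (hm : m < N) (x : WittVector p S) :
    coeff (p ^ m) (LN N x) = WittVector.ghostComponent m x := by
  classical
  rw [LN, map_sum, WittVector.ghostComponent_apply, wittPolynomial_eq_sum_C_mul_X_pow, map_sum]
  symm
  have hsub : Finset.range (m + 1) ⊆ Finset.range N := by
    intro i; simp only [Finset.mem_range]; omega
  rw [← Finset.sum_subset hsub]
  · apply Finset.sum_congr rfl
    intro k hk
    rw [Finset.mem_range] at hk
    have hkm : k ≤ m := by omega
    rw [LN_term, if_pos (pow_dvd_pow p hkm), Nat.pow_div hkm hpf.out.pos, coeff_ell,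
      if_pos ⟨m - k, rfl⟩]
    simp
  · intro k _ hk
    rw [Finset.mem_range] at hk
    rw [LN_term, if_neg, mul_zero]
    intro h
    exact hk (Nat.lt_succ_of_le ((Nat.pow_dvd_pow_iff_le_right hpf.out.one_lt).1 h))

lemma JN_add_torsionfree (hS : ∀ (n : ℕ) (s : S), n ≠ 0 → (n : S) * s = 0 → s = 0) (N : ℕ)
    (x y : WittVector p S) :
    ∀ n < p ^ N, coeff n (JN ρ N (x + y)) = coeff n (JN ρ N x * JN ρ N y) := by
  have h0 : ∀ z : WittVector p S, coeff 0 (LN N z) = 0 := fun z =>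
    LN_coeff_of_not N 0 (by rintro ⟨m, hm⟩; exact ppne m hm.symm) z
  refine theta_unique hS (p ^ N) _ _ (LN N (x + y)) (LN N x + LN N y) (theta_JN ρ N _) ?_ ?_
    (h0 _) ?_
  · rw [theta_mul, theta_JN, theta_JN]; ring
  · intro n hn
    rw [map_add]
    by_cases h : ∃ m, n = p ^ m
    · obtain ⟨m, rfl⟩ := h
      have hm : m < N := (Nat.pow_lt_pow_iff_right hpf.out.one_lt).1 hn
      rw [LN_coeff_pow N m hm, LN_coeff_pow N m hm, LN_coeff_pow N m hm, map_add]
    · rw [LN_coeff_of_not N n h, LN_coeff_of_not N n h, LN_coeff_of_not N n h, add_zero]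
  · rw [JN_zero, coeff_zero_eq_constantCoeff_apply, map_mul, ← coeff_zero_eq_constantCoeff_apply,
      ← coeff_zero_eq_constantCoeff_apply, JN_zero, JN_zero, one_mul]

theorem JN_add (N : ℕ) (x y : WittVector p S) :
    ∀ n < p ^ N, coeff n (JN ρ N (x + y)) = coeff n (JN ρ N x * JN ρ N y) := by
  intro n hn
  let P := MvPolynomial (Bool × ℕ) ℤ_[p]
  let X0 : WittVector p P := WittVector.mk p fun k => MvPolynomial.X (true, k)
  let Y0 : WittVector p P := WittVector.mk p fun k => MvPolynomial.X (false, k)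
  let φ : P →+* S := MvPolynomial.eval₂Hom ρ fun i => if i.1 then x.coeff i.2 else y.coeff i.2
  have hφ : φ.comp MvPolynomial.C = ρ := by
    ext z; exact MvPolynomial.eval₂Hom_C _ _ z
  have hX : WittVector.map φ X0 = x := by
    ext k; rw [WittVector.map_coeff]; exact (MvPolynomial.eval₂Hom_X' _ _ _).trans (by simp)
  have hY : WittVector.map φ Y0 = y := by
    ext k; rw [WittVector.map_coeff]; exact (MvPolynomial.eval₂Hom_X' _ _ _).trans (by simp)
  have key := JN_add_torsionfree (S := P) MvPolynomial.C (fun n s hn h =>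
    (mul_eq_zero.1 h).resolve_left (Nat.cast_ne_zero.2 hn)) N X0 Y0 n hn
  have := congrArg φ key
  rw [← coeff_map, ← coeff_map, map_mul, JN_map, JN_map, JN_map, map_add, hX, hY, hφ] at this
  exact this

end ahProducts

section ahDecomp
open PowerSeries

variable {p : ℕ} [hpf : Fact p.Prime]
variable {S S' : Type*} [CommRing S] [CommRing S'] (ρ : ℤ_[p] →+* S)

/-- `∏_{1 ≤ m < M} E(c_m t^m)`. -/
noncomputable def DM (c : ℕ → S) (M : ℕ) : S⟦X⟧ := ∏ m ∈ Finset.Ico 1 M, Em ρ (c m) m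

lemma DM_succ (c : ℕ → S) {M : ℕ} (hM : 1 ≤ M) : DM ρ c (M + 1) = DM ρ c M * Em ρ (c M) M := by
  rw [DM, DM, Finset.prod_Ico_succ_top hM]

lemma DM_map (φ : S →+* S') (c : ℕ → S) (M : ℕ) :
    map φ (DM ρ c M) = DM (φ.comp ρ) (fun m => φ (c m)) M := by
  rw [DM, DM, map_prod]; simp only [Em_map]

lemma Em_isUnit (c : S) (m : ℕ) : IsUnit (Em ρ c m) := by
  rw [PowerSeries.isUnit_iff_constantCoeff, ← coeff_zero_eq_constantCoeff_apply, Em_coeff_zero]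
  exact isUnit_one

lemma DM_isUnit (c : ℕ → S) (m : ℕ) : IsUnit (DM ρ c m) := by
  rw [DM]
  exact IsUnit.prod_iff.2 fun i _ => Em_isUnit ρ _ _

lemma Em_dvd (c : S) {m : ℕ} (hm : m ≠ 0) : (X : S⟦X⟧) ^ m ∣ Em ρ c m - 1 := by
  rw [X_pow_dvd_iff]
  intro n hn
  rw [map_sub, coeff_one]
  rcases Nat.eq_zero_or_pos n with rfl | h
  · rw [Em_coeff_zero, if_pos rfl, sub_self]
  · rw [Em_coeff_lt ρ c h.ne' hn, if_neg h.ne', sub_self]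

lemma DM_trunc (c : ℕ → S) {m M : ℕ} (h : m + 1 ≤ M) :
    (X : S⟦X⟧) ^ (m + 1) ∣ DM ρ c M - DM ρ c (m + 1) := by
  induction M, h using Nat.le_induction with
  | base => simp
  | succ M hM ih =>
    rw [DM_succ ρ c (by omega)]
    have h1 : (X : S⟦X⟧) ^ (m + 1) ∣ Em ρ (c M) M - 1 :=
      (pow_dvd_pow X hM).trans (Em_dvd ρ _ (by omega))
    have : DM ρ c M * Em ρ (c M) M - DM ρ c (m + 1) =
      DM ρ c M * (Em ρ (c M) M - 1) + (DM ρ c M - DM ρ c (m + 1)) := by ring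
    rw [this]
    exact dvd_add (h1.mul_left _) ih

theorem DM_unique (c c' : ℕ → S) (M : ℕ)
    (h : ∀ n < M, coeff n (DM ρ c M) = coeff n (DM ρ c' M)) :
    ∀ m, 1 ≤ m → m < M → c m = c' m := by
  intro m
  induction m using Nat.strong_induction_on with
  | _ m ih =>
    intro hm hmM
    have hQ : DM ρ c m = DM ρ c' m := by
      rw [DM, DM]
      refine Finset.prod_congr rfl fun i hi => ?_
      rw [Finset.mem_Ico] at hi
      rw [ih i hi.2 hi.1 (by omega)]
    have h0 : (X : S⟦X⟧) ^ (m + 1) ∣ DM ρ c M - DM ρ c' M := by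
      rw [X_pow_dvd_iff]
      intro n hn
      rw [map_sub, h n (by omega), sub_self]
    have h1 := DM_trunc ρ c (show m + 1 ≤ M from hmM)
    have h2 := DM_trunc ρ c' (show m + 1 ≤ M from hmM)
    have h3 : (X : S⟦X⟧) ^ (m + 1) ∣ DM ρ c (m + 1) - DM ρ c' (m + 1) := by
      have := dvd_add (dvd_sub h0 h1) h2
      convert this using 1
      ring
    rw [DM_succ ρ c hm, DM_succ ρ c' hm, hQ, ← mul_sub, (DM_isUnit ρ c' m).dvd_mul_left,
      X_pow_dvd_iff] at h3
    have := h3 m (Nat.lt_succ_self m)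
    rw [map_sub, Em_coeff_self ρ _ (by omega), Em_coeff_self ρ _ (by omega)] at this
    exact sub_eq_zero.1 this

/-- Splitting off the `p`-power indices. -/
lemma DM_split (N : ℕ) (c : ℕ → S) (z : WittVector p S) (hz : ∀ k < N, c (p ^ k) = z.coeff k) :
    DM ρ c (p ^ N) = JN ρ N z *
      ∏ m ∈ Finset.Ico 1 (p ^ N) \ (Finset.range N).image (fun k => p ^ k), Em ρ (c m) m := by
  have hsub : (Finset.range N).image (fun k => p ^ k) ⊆ Finset.Ico 1 (p ^ N) := by
    intro m hm
    rw [Finset.mem_image] at hm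
    obtain ⟨k, hk, rfl⟩ := hm
    rw [Finset.mem_range] at hk
    rw [Finset.mem_Ico]
    exact ⟨Nat.one_le_iff_ne_zero.2 (ppne k), Nat.pow_lt_pow_right hpf.out.one_lt hk⟩
  rw [DM, ← Finset.prod_sdiff hsub, mul_comm]
  congr 1
  rw [Finset.prod_image (fun a _ b _ hab => Nat.pow_right_injective hpf.out.two_le hab), JN]
  exact Finset.prod_congr rfl fun k hk => by rw [hz k (Finset.mem_range.1 hk)]

/-- filtered part -/
lemma fil_cancel (I : ℕ → Ideal S) (hmul : ∀ m n, I m * I n ≤ I (m + n)) (f h : S⟦X⟧)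
    (hf0 : coeff 0 f = 1) (hf : ∀ n, coeff n f ∈ I n) (hfh : ∀ n, coeff n (f * h) ∈ I n) :
    ∀ n, coeff n h ∈ I n := by
  intro n
  induction n using Nat.strong_induction_on with
  | _ n ih =>
    have h1 := hfh n
    rw [coeff_mul, Finset.Nat.sum_antidiagonal_eq_sum_range_succ_mk, Finset.sum_range_succ'] at h1
    simp only [hf0, Nat.sub_zero, one_mul] at h1
    refine (Ideal.add_mem_iff_right _ (Ideal.sum_mem _ fun i hi => ?_)).1 h1
    rw [Finset.mem_range] at hi
    have := hmul (i + 1) (n - (i + 1)) (Ideal.mul_mem_mul (hf (i + 1)) (ih (n - (i + 1)) (by omega)))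
    rwa [Nat.add_sub_cancel' (by omega : i + 1 ≤ n)] at this

lemma Em_fil (I : ℕ → Ideal S) (hI0 : I 0 = ⊤) (hmul : ∀ m n, I m * I n ≤ I (m + n)) (c : S)
    {m : ℕ} (hm : m ≠ 0) (hc : c ∈ I m) (n : ℕ) : coeff n (Em ρ c m) ∈ I n := by
  rw [Em_coeff ρ c hm]
  split_ifs with h
  · obtain ⟨k, rfl⟩ := h
    rw [Nat.mul_div_cancel_left _ (Nat.pos_of_ne_zero hm)]
    apply Ideal.mul_mem_right
    induction k with
    | zero => simp [hI0]
    | succ k ih =>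
      rw [pow_succ, Nat.mul_succ]
      exact hmul _ _ (Ideal.mul_mem_mul ih hc)
  · exact zero_mem _

lemma decomp_step (I : ℕ → Ideal S) (hI0 : I 0 = ⊤) (hmul : ∀ m n, I m * I n ≤ I (m + n))
    (v : S⟦X⟧) (hv0 : coeff 0 v = 1) (hv : ∀ n, coeff n v ∈ I n) (M : ℕ) (hM : 1 ≤ M) :
    ∃ b : ℕ → S, (∀ m, b m ∈ I m) ∧ ∃ h : S⟦X⟧, v = DM ρ b M * h ∧ (∀ n, coeff n h ∈ I n) ∧
      (X : S⟦X⟧) ^ M ∣ h - 1 := by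
  induction M, hM using Nat.le_induction with
  | base =>
    refine ⟨fun _ => 0, fun _ => zero_mem _, v, by simp [DM], hv, ?_⟩
    rw [X_pow_dvd_iff]
    intro m hm
    obtain rfl : m = 0 := by omega
    rw [map_sub, hv0]; simp
  | succ M hM ih =>
    obtain ⟨b, hb, h, hvh, hfil, hdvd⟩ := ih
    obtain ⟨w, hw⟩ := (Em_isUnit ρ (coeff M h) M).exists_right_inv
    have hM0 : M ≠ 0 := by omega
    have hEfil := Em_fil ρ I hI0 hmul (coeff M h) hM0 (hfil M)
    have hprod : Em ρ (coeff M h) M * (w * h) = h := by rw [← mul_assoc, hw, one_mul]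
    refine ⟨Function.update b M (coeff M h), ?_, w * h, ?_, ?_, ?_⟩
    · intro m
      by_cases hm : m = M
      · subst hm; simpa using hfil m
      · rw [Function.update_of_ne hm]; exact hb m
    · rw [DM_succ ρ _ hM, Function.update_self, mul_assoc, hprod, hvh]
      congr 1
      rw [DM, DM]
      refine Finset.prod_congr rfl fun i hi => ?_
      rw [Finset.mem_Ico] at hi
      rw [Function.update_of_ne (by omega)]
    · apply fil_cancel I hmul (Em ρ (coeff M h) M) _ (Em_coeff_zero _ _ _) hEfil
      rw [hprod]; exact hfil
    · have e : w * h - 1 = w * (h - Em ρ (coeff M h) M) := by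
        rw [mul_sub, mul_comm w (Em ρ _ M), hw]
      rw [e]
      apply Dvd.dvd.mul_left
      rw [X_pow_dvd_iff]
      intro n hn
      rcases Nat.lt_succ_iff_lt_or_eq.1 hn with hn | rfl
      · have h1 := (X_pow_dvd_iff.1 hdvd) n hn
        have h2 := (X_pow_dvd_iff.1 (Em_dvd ρ (coeff M h) hM0)) n hn
        rw [map_sub] at h1 h2 ⊢
        rw [sub_eq_zero.1 h1, sub_eq_zero.1 h2, sub_self]
      · rw [map_sub, Em_coeff_self ρ _ hM0, sub_self]

/-- Every polynomial `1 + nilpotent` is a finite product of Artin-Hasse factors with nilpotent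
parameters. -/
theorem decomp (v : Polynomial S) (hv0 : v.coeff 0 = 1)
    (hn : ∀ n, n ≠ 0 → IsNilpotent (v.coeff n)) :
    ∃ (b : ℕ → S) (M : ℕ), (∀ m, IsNilpotent (b m)) ∧ (∀ m, M ≤ m → b m = 0) ∧
      ∀ M', M ≤ M' → (v : S⟦X⟧) = DM ρ b M' := by
  classical
  set d := v.natDegree + 1 with hd
  have hd0 : 0 < d := Nat.succ_pos _
  set I0 : Ideal S := Ideal.span ((Finset.Ico 1 d).image v.coeff : Finset S) with hI0
  have hnil : IsNilpotent I0 := by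
    have hle : I0 ≤ nilradical S := by
      rw [hI0, Ideal.span_le]
      intro s hs
      simp only [Finset.coe_image, Set.mem_image, Finset.coe_Ico, Set.mem_Ico] at hs
      obtain ⟨n, hn1, rfl⟩ := hs
      exact mem_nilradical.2 (hn n (by omega))
    exact (Ideal.FG.isNilpotent_iff_le_nilradical ⟨_, rfl⟩).2 hle
  obtain ⟨K, hK⟩ := hnil
  set I : ℕ → Ideal S := fun n => I0 ^ (n ⌈/⌉ d) with hI
  have hmul : ∀ m n, I m * I n ≤ I (m + n) := by
    intro m n
    rw [hI]
    simp only
    rw [← pow_add]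
    apply Ideal.pow_le_pow_right
    rw [ceilDiv_le_iff_le_smul hd0]
    have h1 := le_smul_ceilDiv (a := d) (b := m) hd0
    have h2 := le_smul_ceilDiv (a := d) (b := n) hd0
    rw [smul_add]; omega
  have hItop : I 0 = ⊤ := by simp [hI]
  have hvI : ∀ n, coeff n (v : S⟦X⟧) ∈ I n := by
    intro n
    rw [Polynomial.coeff_coe]
    rcases Nat.eq_zero_or_pos n with rfl | hpos
    · rw [hItop]; trivial
    by_cases hnd : n < d
    · have h1 : n ⌈/⌉ d ≤ 1 := by rw [ceilDiv_le_iff_le_smul hd0]; simp; omega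
      apply Ideal.pow_le_pow_right h1
      rw [pow_one]
      apply Ideal.subset_span
      simp only [Finset.coe_image, Set.mem_image, Finset.coe_Ico, Set.mem_Ico]
      exact ⟨n, ⟨hpos, hnd⟩, rfl⟩
    · rw [Polynomial.coeff_eq_zero_of_natDegree_lt (by omega)]; exact zero_mem _
  have hIbot : ∀ n, d * K ≤ n → I n = ⊥ := by
    intro n hn
    have : K ≤ n ⌈/⌉ d := by
      by_contra hlt
      have hlt' : n ⌈/⌉ d ≤ K - 1 := by omega
      rw [ceilDiv_le_iff_le_smul hd0, smul_eq_mul] at hlt'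
      have : d * (K - 1) < d * K := Nat.mul_lt_mul_of_pos_left (by omega) hd0
      omega
    rw [hI]
    simp only
    rw [← Ideal.zero_eq_bot]
    exact pow_eq_zero_of_le this hK
  have hnilI : ∀ m, m ≠ 0 → ∀ s ∈ I m, IsNilpotent s := by
    intro m hm s hs
    have h1 : 1 ≤ m ⌈/⌉ d := by
      by_contra hlt
      have hlt' : m ⌈/⌉ d ≤ 0 := by omega
      rw [ceilDiv_le_iff_le_smul hd0] at hlt'
      simp at hlt'; omega
    have h2 := Ideal.pow_le_pow_right h1 hs
    rw [pow_one] at h2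
    refine ⟨K, ?_⟩
    have := Ideal.pow_mem_pow h2 K
    rw [hK] at this
    simpa using this
  set M := d * K + 1 with hM
  obtain ⟨b, hb, h, hvh, hfil, hdvd⟩ := decomp_step ρ I hItop hmul (v : S⟦X⟧)
    (by rw [Polynomial.coeff_coe, hv0]) hvI M (by omega)
  have hh : h = 1 := by
    ext n
    by_cases hn : n < M
    · have := X_pow_dvd_iff.1 hdvd n hn
      rw [map_sub] at this
      exact sub_eq_zero.1 this
    · have h1 := hfil n
      rw [hIbot n (by omega)] at h1
      rw [(Submodule.mem_bot S).1 h1, coeff_one, if_neg (by omega)]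
  rw [hh, mul_one] at hvh
  refine ⟨fun m => if m = 0 then 0 else b m, M, ?_, ?_, ?_⟩
  · intro m
    simp only
    split_ifs with hm
    · exact IsNilpotent.zero
    · exact hnilI m hm _ (hb m)
  · intro m hm
    simp only
    rw [if_neg (by omega)]
    have h1 := hb m
    rw [hIbot m (by omega)] at h1
    exact (Submodule.mem_bot S).1 h1
  · intro M' hM'
    rw [hvh, DM, DM]
    have hsub : Finset.Ico 1 M ⊆ Finset.Ico 1 M' := Finset.Ico_subset_Ico_right hM'
    symm
    rw [← Finset.prod_subset hsub]
    · refine Finset.prod_congr rfl fun i hi => ?_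
      rw [Finset.mem_Ico] at hi
      rw [if_neg (by omega)]
    · intro m hm hm'
      rw [Finset.mem_Ico] at hm hm'
      have h1 := hb m
      rw [hIbot m (by omega)] at h1
      rw [if_neg (by omega), (Submodule.mem_bot S).1 h1, Em_zero]

/-- `J(x)` is a polynomial `1 + nilpotent`. -/
lemma Em_poly (c : S) (hc : IsNilpotent c) {m : ℕ} (hm : m ≠ 0) :
    ∃ q : Polynomial S, (q : S⟦X⟧) = Em ρ c m ∧ q.coeff 0 = 1 ∧ IsNilpotent (q - 1) := by
  obtain ⟨r, hr⟩ := hc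
  have hq : (trunc (m * (r + 1)) (Em ρ c m) : S⟦X⟧) = Em ρ c m := by
    ext n
    rw [Polynomial.coeff_coe, coeff_trunc]
    split_ifs with h
    · rfl
    · rw [Em_coeff ρ c hm]
      split_ifs with h'
      · obtain ⟨k, rfl⟩ := h'
        have hk : r + 1 ≤ k := Nat.le_of_mul_le_mul_left (not_lt.1 h) (Nat.pos_of_ne_zero hm)
        rw [Nat.mul_div_cancel_left _ (Nat.pos_of_ne_zero hm),
          pow_eq_zero_of_le (by omega) hr, zero_mul]
      · rfl
  have h0 : (trunc (m * (r + 1)) (Em ρ c m)).coeff 0 = 1 := by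
    rw [← Polynomial.coeff_coe, hq, Em_coeff_zero]
  refine ⟨_, hq, h0, ?_⟩
  rw [Polynomial.isNilpotent_iff]
  intro n
  rw [Polynomial.coeff_sub, Polynomial.coeff_one]
  rcases Nat.eq_zero_or_pos n with rfl | hn
  · rw [h0]; simp
  · rw [if_neg hn.ne', sub_zero, ← Polynomial.coeff_coe, hq, Em_coeff ρ c hm]
    split_ifs with h'
    · obtain ⟨k, rfl⟩ := h'
      have hk : k ≠ 0 := by rintro rfl; simp at hn
      rw [Nat.mul_div_cancel_left _ (Nat.pos_of_ne_zero hm)]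
      refine ⟨r, ?_⟩
      rw [mul_pow, ← pow_mul, pow_eq_zero_of_le (Nat.le_mul_of_pos_left r (Nat.pos_of_ne_zero hk)) hr,
        zero_mul]
    · exact IsNilpotent.zero

lemma JN_poly (x : WittVector p S) (hx : ∀ n, IsNilpotent (x.coeff n)) (N : ℕ) :
    ∃ q : Polynomial S, (q : S⟦X⟧) = JN ρ N x ∧ q.coeff 0 = 1 ∧ IsNilpotent (q - 1) := by
  induction N with
  | zero => exact ⟨1, by simp [JN], by simp, by simp⟩
  | succ N ih =>
    obtain ⟨q, hq, hq0, hqn⟩ := ih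
    obtain ⟨r, hr, hr0, hrn⟩ := Em_poly ρ (x.coeff N) (hx N) (ppne (p := p) N)
    refine ⟨q * r, ?_, ?_, ?_⟩
    · rw [Polynomial.coe_mul, hq, hr, JN, JN, Finset.prod_range_succ]
    · rw [Polynomial.mul_coeff_zero, hq0, hr0, one_mul]
    · have : q * r - 1 = q * (r - 1) + (q - 1) := by ring
      rw [this]
      exact Commute.isNilpotent_add (Commute.all _ _) ((Commute.all _ _).isNilpotent_mul_left hrn) hqn

lemma JN_stable (x : WittVector p S) (N : ℕ) (hx : ∀ n ≥ N, x.coeff n = 0) (M : ℕ) (hM : N ≤ M) :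
    JN ρ M x = JN ρ N x := by
  induction M, hM using Nat.le_induction with
  | base => rfl
  | succ M hM ih =>
    rw [← ih, JN, JN, Finset.prod_range_succ, hx M hM, Em_zero, mul_one]

end ahDecomp

section final
open PowerSeries TensorProduct Algebra.TensorProduct

lemma exists_rho (p : ℕ) [hpf : Fact p.Prime] {R : Type*} [CommRing R] (hp : IsNilpotent (p : R)) :
    Nonempty (ℤ_[p] →+* R) := by
  obtain ⟨k, hk⟩ := hp
  have h : ((p ^ k : ℕ) : R) = 0 := by push_cast; exact hk
  exact ⟨((Ideal.Quotient.lift (Ideal.span {((p ^ k : ℕ) : ℤ)}) (Int.castRingHom R) (by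
      intro a ha
      obtain ⟨b, rfl⟩ := Ideal.mem_span_singleton.1 ha
      simp only [map_mul, eq_intCast, Int.cast_natCast, h, zero_mul])).comp
      ((Int.quotientSpanNatEquivZMod (p ^ k)).symm.toRingHom.comp (PadicInt.toZModPow k)))⟩

lemma map_coe {S S' : Type*} [CommRing S] [CommRing S'] (φ : S →+* S') (q : Polynomial S) :
    ((q.map φ : Polynomial S') : S'⟦X⟧) = PowerSeries.map φ (q : S⟦X⟧) := by
  ext n; simp

theorem final_core (p : ℕ) [hpf : Fact p.Prime] {R R' : Type*} [CommRing R] [CommRing R']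
    [Algebra R R'] [Module.FaithfullyFlat R R'] (hp : IsNilpotent (p : R))
    (hsn : IsSeminormalRing (R ⧸ nilradical R)) (x : WittVector p (R' ⊗[R] R'))
    (hx : ∀ n, IsNilpotent (x.coeff n)) (hfin : ∃ N, ∀ n ≥ N, x.coeff n = 0)
    (hc : WittVector.map (Algebra.TensorProduct.map (includeLeft : R' →ₐ[R] R' ⊗[R] R')
        (AlgHom.id R R')).toRingHom x =
      WittVector.map (Algebra.TensorProduct.map (includeRight : R' →ₐ[R] R' ⊗[R] R')
        (AlgHom.id R R')).toRingHom x +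
      WittVector.map (includeLeft : R' ⊗[R] R' →ₐ[R] (R' ⊗[R] R') ⊗[R] R').toRingHom x) :
    ∃ y : WittVector p R', (∀ n, IsNilpotent (y.coeff n)) ∧ (∃ N, ∀ n ≥ N, y.coeff n = 0) ∧
      WittVector.map (includeRight : R' →ₐ[R] R' ⊗[R] R').toRingHom y =
      x + WittVector.map (includeLeft : R' →ₐ[R] R' ⊗[R] R').toRingHom y := by
  classical
  obtain ⟨ρ⟩ := exists_rho p hp
  obtain ⟨N, hN⟩ := hfin
  set ρ1 : ℤ_[p] →+* R' := (algebraMap R R').comp ρ with hρ1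
  set ρ2 : ℤ_[p] →+* R' ⊗[R] R' := (algebraMap R _).comp ρ with hρ2
  set ρ3 : ℤ_[p] →+* (R' ⊗[R] R') ⊗[R] R' := (algebraMap R _).comp ρ with hρ3
  have h12 : ∀ φ : R' →ₐ[R] R' ⊗[R] R', φ.toRingHom.comp ρ1 = ρ2 := by
    intro φ; ext z; exact φ.commutes _
  have h23 : ∀ φ : R' ⊗[R] R' →ₐ[R] (R' ⊗[R] R') ⊗[R] R', φ.toRingHom.comp ρ2 = ρ3 := by
    intro φ; ext z; exact φ.commutes _
  obtain ⟨u, hu, hu0, hun⟩ := JN_poly ρ2 x hx N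
  have hunit : IsUnit u := by simpa using hun.isUnit_one_add
  obtain ⟨w, hw⟩ := hunit.exists_right_inv
  have hucoef : ∀ n, 1 ≤ n → IsNilpotent (u.coeff n) := by
    intro n hn
    have := (Polynomial.isNilpotent_iff.1 hun) n
    rwa [Polynomial.coeff_sub, Polynomial.coeff_one, if_neg (by omega), sub_zero] at this
  have hmapu : ∀ (φ : R' ⊗[R] R' →ₐ[R] (R' ⊗[R] R') ⊗[R] R') (M : ℕ), N ≤ M →
      ((u.map φ.toRingHom : Polynomial _) : ((R' ⊗[R] R') ⊗[R] R')⟦X⟧) =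
        JN ρ3 M (WittVector.map φ.toRingHom x) := by
    intro φ M hM
    rw [map_coe, hu, ← JN_stable ρ2 x N hN M hM, JN_map, h23]
  have hcu : u.map (Algebra.TensorProduct.map (includeLeft : R' →ₐ[R] R' ⊗[R] R')
        (AlgHom.id R R')).toRingHom =
      u.map (Algebra.TensorProduct.map (includeRight : R' →ₐ[R] R' ⊗[R] R')
        (AlgHom.id R R')).toRingHom *
      u.map (includeLeft : R' ⊗[R] R' →ₐ[R] (R' ⊗[R] R') ⊗[R] R').toRingHom := by
    ext n
    have hM : N ≤ N + n := by omega
    have hlt : n < p ^ (N + n) :=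
      lt_of_le_of_lt (by omega : n ≤ N + n) (Nat.lt_pow_self hpf.out.one_lt)
    have key := JN_add ρ3 (N + n) (WittVector.map (Algebra.TensorProduct.map
        (includeRight : R' →ₐ[R] R' ⊗[R] R') (AlgHom.id R R')).toRingHom x)
      (WittVector.map (includeLeft : R' ⊗[R] R' →ₐ[R] (R' ⊗[R] R') ⊗[R] R').toRingHom x) n hlt
    rw [← hc, ← hmapu _ _ hM, ← hmapu _ _ hM, ← hmapu _ _ hM, ← Polynomial.coe_mul,
      Polynomial.coeff_coe, Polynomial.coeff_coe] at key
    exact key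
  obtain ⟨v, v', hvv, hv0, hvc⟩ := unit_coboundary p hp hsn u w hw hu0 hucoef hcu
  have hvn : ∀ n, n ≠ 0 → IsNilpotent (v.coeff n) :=
    (Polynomial.isUnit_iff_coeff_isUnit_isNilpotent.1 (IsUnit.of_mul_eq_one v' hvv)).2
  obtain ⟨b, M, hbn, hb0, hbv⟩ := decomp ρ1 v hv0 hvn
  set iR := (includeRight : R' →ₐ[R] R' ⊗[R] R').toRingHom with hiR
  set iL := (includeLeft : R' →ₐ[R] R' ⊗[R] R').toRingHom with hiL
  set y : WittVector p R' := WittVector.mk p fun k => b (p ^ k) with hy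
  have hyc : ∀ k, y.coeff k = b (p ^ k) := fun k => by rw [hy, WittVector.coeff_mk]
  refine ⟨y, fun n => by rw [hyc]; exact hbn _, ⟨M, fun n hn => ?_⟩, ?_⟩
  · rw [hyc]
    exact hb0 _ (hn.trans (Nat.lt_pow_self hpf.out.one_lt).le)
  ext k
  rw [WittVector.map_coeff]
  set L := N + M + k + 1 with hL
  have hML : M ≤ p ^ L :=
    le_trans (by omega : M ≤ L) (Nat.lt_pow_self hpf.out.one_lt).le
  have hkL : p ^ k < p ^ L := Nat.pow_lt_pow_right hpf.out.one_lt (by omega)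
  set z : WittVector p (R' ⊗[R] R') := x + WittVector.map iL y with hz
  set c : ℕ → R' ⊗[R] R' := fun m =>
    if p ^ (Nat.log p m) = m then z.coeff (Nat.log p m) else iL (b m) with hcdef
  have hcp : ∀ j, c (p ^ j) = z.coeff j := by
    intro j
    rw [hcdef]
    simp only [Nat.log_pow hpf.out.one_lt, if_true]
  have hR : PowerSeries.map iR (v : R'⟦X⟧) = DM ρ2 (fun m => iR (b m)) (p ^ L) := by
    rw [hbv _ hML, DM_map, h12]
  have hLv : PowerSeries.map iL (v : R'⟦X⟧) = DM ρ2 (fun m => iL (b m)) (p ^ L) := by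
    rw [hbv _ hML, DM_map, h12]
  have hvc' : PowerSeries.map iR (v : R'⟦X⟧) = JN ρ2 L x * PowerSeries.map iL (v : R'⟦X⟧) := by
    rw [← map_coe, ← map_coe, JN_stable ρ2 x N hN L (by omega), ← hu, ← Polynomial.coe_mul, hvc]
  rw [hR, hLv, DM_split ρ2 L (fun m => iL (b m)) (WittVector.map iL y)
    (fun j _ => by rw [WittVector.map_coeff, hyc]), ← mul_assoc] at hvc'
  have hc2 := DM_split ρ2 L c z (fun j _ => hcp j)
  have hQ : (∏ m ∈ Finset.Ico 1 (p ^ L) \ (Finset.range L).image (fun k => p ^ k), Em ρ2 (c m) m) =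
      ∏ m ∈ Finset.Ico 1 (p ^ L) \ (Finset.range L).image (fun k => p ^ k),
        Em ρ2 (iL (b m)) m := by
    refine Finset.prod_congr rfl fun m hm => ?_
    rw [Finset.mem_sdiff, Finset.mem_Ico, Finset.mem_image] at hm
    have : p ^ (Nat.log p m) ≠ m := by
      intro h
      apply hm.2
      refine ⟨Nat.log p m, ?_, h⟩
      rw [Finset.mem_range]
      rw [← Nat.pow_lt_pow_iff_right hpf.out.one_lt, h]
      exact hm.1.2
    rw [hcdef]
    simp only [if_neg this]
  rw [hQ] at hc2
  have hdvd : (X : (R' ⊗[R] R')⟦X⟧) ^ (p ^ L) ∣ JN ρ2 L z - JN ρ2 L x * JN ρ2 L (WittVector.map iL y) := by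
    rw [X_pow_dvd_iff]
    intro n hn
    rw [map_sub, JN_add ρ2 L x _ n hn, sub_self]
  have hdvd2 : (X : (R' ⊗[R] R')⟦X⟧) ^ (p ^ L) ∣
      DM ρ2 c (p ^ L) - DM ρ2 (fun m => iR (b m)) (p ^ L) := by
    rw [hc2, hvc', ← sub_mul]
    exact hdvd.mul_right _
  have huniq := DM_unique ρ2 c (fun m => iR (b m)) (p ^ L) (fun n hn => by
    have := X_pow_dvd_iff.1 hdvd2 n hn
    rw [map_sub] at this
    exact sub_eq_zero.1 this) (p ^ k) (Nat.one_le_iff_ne_zero.2 (ppne k)) hkL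
  rw [hcp] at huniq
  rw [huniq, hyc]

end final

/-- Vanishing of `Ȟ¹(R'/R, Ŵ)`: every Čech 1-cocycle of `Ŵ` for a faithfully flat
covering of a p-nilpotent ring with seminormal reduction is a coboundary. -/
theorem hatW_cech_H1_vanishes_of_seminormal_reduction (p : ℕ) [Fact p.Prime]
    (R R' : Type u) [CommRing R] [CommRing R'] [Algebra R R']
    (hp : IsNilpotent (p : R))
    (hsn : IsSeminormalRing (R ⧸ nilradical R))
    [Module.FaithfullyFlat R R'] :
    ∀ x : WittVector p (cechAlg (R := R) R' 1).carrier,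
      IsHatW p x → cechWittD p R' 1 x = 0 →
        ∃ y : WittVector p (cechAlg (R := R) R' 0).carrier,
          IsHatW p y ∧ cechWittD p R' 0 y = x := by
  intro x hx hd
  have hd' : WittVector.map (p := p) (Algebra.TensorProduct.map
        (Algebra.TensorProduct.includeRight : R' →ₐ[R] R' ⊗[R] R') (AlgHom.id R R')).toRingHom x -
      WittVector.map (p := p) (Algebra.TensorProduct.map
        (Algebra.TensorProduct.includeLeft : R' →ₐ[R] R' ⊗[R] R') (AlgHom.id R R')).toRingHom x +
      WittVector.map (p := p) (Algebra.TensorProduct.includeLeft :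
        R' ⊗[R] R' →ₐ[R] (R' ⊗[R] R') ⊗[R] R').toRingHom x = 0 := by
    have h := hd
    rw [cechWittD, Fin.sum_univ_three] at h
    have e1 : ((-1 : ℤ) ^ ((0 : Fin 3) : ℕ)) = 1 := by simp
    have e2 : ((-1 : ℤ) ^ ((1 : Fin 3) : ℕ)) = -1 := by simp
    have e3 : ((-1 : ℤ) ^ ((2 : Fin 3) : ℕ)) = 1 := by simp
    rw [e1, e2, e3, one_smul, one_smul, neg_smul, one_smul, ← sub_eq_add_neg] at h
    exact h
  have key := final_core p (R := R) (R' := R') hp hsn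
  obtain ⟨y, hy1, hy2, hy⟩ := key x hx.1 hx.2 (by
    have := hd'
    rw [sub_add_eq_add_sub, sub_eq_zero] at this
    exact this.symm)
  refine ⟨y, ⟨hy1, hy2⟩, ?_⟩
  have hgoal : WittVector.map (p := p)
        (Algebra.TensorProduct.includeRight : R' →ₐ[R] R' ⊗[R] R').toRingHom y -
      WittVector.map (p := p)
        (Algebra.TensorProduct.includeLeft : R' →ₐ[R] R' ⊗[R] R').toRingHom y = x := by
    rw [hy]; exact add_sub_cancel_right _ _
  rw [cechWittD, Fin.sum_univ_two]
  have e1 : ((-1 : ℤ) ^ ((0 : Fin 2) : ℕ)) = 1 := by simp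
  have e2 : ((-1 : ℤ) ^ ((1 : Fin 2) : ℕ)) = -1 := by simp
  rw [e1, e2, one_smul, neg_smul, one_smul, ← sub_eq_add_neg]
  exact hgoal
end

section
/- Let p be a prime. In the ring W(ℤ_p) of p-typical Witt vectors of the p-adic integers, there exists a unique element u₀ with V(u₀) = p·1 − [p], where [p] is the Teichmüller representative of p ∈ ℤ_p; moreover this element u₀ is a unit of W(ℤ_p). -/
/-- Recursive solution of the ghost equations. -/
noncomputable def dworkCoeff (p : ℕ) [Fact p.Prime] (a : ℕ → ℤ_[p]) : ℕ → ℤ_[p]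
  | n => Classical.epsilon (fun c : ℤ_[p] =>
      a n = ∑ i : Fin n, (p : ℤ_[p]) ^ (i : ℕ) * dworkCoeff p a i ^ p ^ (n - i) + (p : ℤ_[p]) ^ n * c)
decreasing_by exact i.2

theorem padic_dvd_pow_sub (p : ℕ) [hp : Fact p.Prime] (x : ℤ_[p]) : (p : ℤ_[p]) ∣ x ^ p - x := by
  rw [← Ideal.mem_span_singleton, ← PadicInt.maximalIdeal_eq_span_p, ← PadicInt.ker_toZMod,
    RingHom.mem_ker]
  simp [ZMod.pow_card]

theorem dworkCoeff_spec (p : ℕ) [hp : Fact p.Prime] (a : ℕ → ℤ_[p])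
    (ha : ∀ n, (p : ℤ_[p]) ^ (n + 1) ∣ a (n + 1) - a n) (n : ℕ) :
    a n = ∑ i ∈ Finset.range (n + 1), (p : ℤ_[p]) ^ i * dworkCoeff p a i ^ p ^ (n - i) := by
  induction n with
  | zero =>
    have h : ∃ c : ℤ_[p], a 0 = ∑ i : Fin 0, (p : ℤ_[p]) ^ (i : ℕ) *
        dworkCoeff p a i ^ p ^ (0 - (i : ℕ)) + (p : ℤ_[p]) ^ 0 * c := ⟨a 0, by simp⟩
    have := Classical.epsilon_spec h
    rw [← dworkCoeff] at this
    simpa using this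
  | succ n ih =>
    have h : ∃ c : ℤ_[p], a (n + 1) = ∑ i : Fin (n + 1), (p : ℤ_[p]) ^ (i : ℕ) *
        dworkCoeff p a i ^ p ^ (n + 1 - (i : ℕ)) + (p : ℤ_[p]) ^ (n + 1) * c := by
      have key : (p : ℤ_[p]) ^ (n + 1) ∣ a (n + 1) - ∑ i ∈ Finset.range (n + 1),
          (p : ℤ_[p]) ^ i * dworkCoeff p a i ^ p ^ (n + 1 - i) := by
        have h2 : (p : ℤ_[p]) ^ (n + 1) ∣ ∑ i ∈ Finset.range (n + 1),
          ((p : ℤ_[p]) ^ i * dworkCoeff p a i ^ p ^ (n + 1 - i)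
            - (p : ℤ_[p]) ^ i * dworkCoeff p a i ^ p ^ (n - i)) := by
          apply Finset.dvd_sum
          intro i hi
          have hi' : i ≤ n := by simpa [Nat.lt_succ_iff] using hi
          have h3 := dvd_sub_pow_of_dvd_sub (padic_dvd_pow_sub p (dworkCoeff p a i)) (n - i)
          rw [← pow_mul, ← pow_succ', show n - i + 1 = n + 1 - i by omega] at h3
          rw [← mul_sub]
          have h4 := mul_dvd_mul_left ((p : ℤ_[p]) ^ i) h3
          rwa [← pow_add, show i + (n + 1 - i) = n + 1 by omega] at h4
        rw [Finset.sum_sub_distrib, ← ih] at h2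
        have := dvd_sub (ha n) h2
        convert this using 1
        ring
      obtain ⟨c, hc⟩ := key
      refine ⟨c, ?_⟩
      rw [Fin.sum_univ_eq_sum_range (fun i => (p : ℤ_[p]) ^ i *
        dworkCoeff p a i ^ p ^ (n + 1 - i)), ← hc]
      ring
    have := Classical.epsilon_spec h
    rw [← dworkCoeff] at this
    rw [Fin.sum_univ_eq_sum_range (fun i => (p : ℤ_[p]) ^ i *
        dworkCoeff p a i ^ p ^ (n + 1 - i))] at this
    rw [Finset.sum_range_succ]
    simpa using this

theorem exists_ghost (p : ℕ) [hp : Fact p.Prime] (a : ℕ → ℤ_[p])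
    (ha : ∀ n, (p : ℤ_[p]) ^ (n + 1) ∣ a (n + 1) - a n) :
    ∃ y : WittVector p ℤ_[p], ∀ n, WittVector.ghostComponent n y = a n :=
  ⟨WittVector.mk p (dworkCoeff p a), fun n => by
    rw [WittVector.ghostComponent_apply, aeval_wittPolynomial, dworkCoeff_spec p a ha n]
    rfl⟩

theorem ghost_inj (p : ℕ) [hp : Fact p.Prime] (x y : WittVector p ℤ_[p])
    (h : ∀ n, WittVector.ghostComponent n x = WittVector.ghostComponent n y) : x = y := by
  have hinj : Function.Injective (PadicInt.Coe.ringHom : ℤ_[p] →+* ℚ_[p]) :=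
    Subtype.coe_injective
  apply WittVector.map_injective _ hinj
  have : Invertible (p : ℚ_[p]) := invertibleOfNonzero (by exact_mod_cast hp.out.ne_zero)
  apply (WittVector.ghostMap.bijective_of_invertible p ℚ_[p]).1
  funext n
  have hm : ∀ z : WittVector p ℤ_[p], WittVector.ghostMap
      (WittVector.map (PadicInt.Coe.ringHom : ℤ_[p] →+* ℚ_[p]) z) n =
      PadicInt.Coe.ringHom (WittVector.ghostComponent n z) := by
    intro z
    simp only [WittVector.ghostMap_apply, WittVector.ghostComponent_apply, aeval_wittPolynomial,
      WittVector.map_coeff, map_sum, map_mul, map_pow, map_natCast]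
  rw [hm, hm, h]

theorem sheared_witt_exists_unique_u0 (p : ℕ) [hp : Fact p.Prime] :
    (∃! u₀ : WittVector p ℤ_[p],
        WittVector.verschiebung u₀ =
          (p : WittVector p ℤ_[p]) - WittVector.teichmuller p (p : ℤ_[p])) ∧
    (∀ u₀ : WittVector p ℤ_[p],
        WittVector.verschiebung u₀ =
          (p : WittVector p ℤ_[p]) - WittVector.teichmuller p (p : ℤ_[p]) →
        IsUnit u₀) := by
  have hp0 : (p : ℤ_[p]) ≠ 0 := by exact_mod_cast hp.out.ne_zero
  constructor
  · have h0 : ((p : WittVector p ℤ_[p]) - WittVector.teichmuller p (p : ℤ_[p])).coeff 0 = 0 := by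
      change WittVector.constantCoeff
        ((p : WittVector p ℤ_[p]) - WittVector.teichmuller p (p : ℤ_[p])) = 0
      rw [map_sub, map_natCast]
      change _ - (WittVector.teichmuller p (p : ℤ_[p])).coeff 0 = 0
      rw [WittVector.teichmuller_coeff_zero, sub_self]
    have h1 := WittVector.eq_iterate_verschiebung (n := 1)
      (x := (p : WittVector p ℤ_[p]) - WittVector.teichmuller p (p : ℤ_[p]))
      (by intro i hi; obtain rfl : i = 0 := by omega
          exact h0)
    refine ⟨_, h1.symm, fun y hy => ?_⟩
    exact WittVector.verschiebung_injective p ℤ_[p] (hy.trans h1)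
  · intro u hu
    have hg : ∀ n, WittVector.ghostComponent n u = 1 - (p : ℤ_[p]) ^ (p ^ (n + 1) - 1) := by
      intro n
      have h := congrArg (WittVector.ghostComponent (n + 1)) hu
      rw [WittVector.ghostComponent_verschiebung, map_sub, map_natCast,
        WittVector.ghostComponent_teichmuller] at h
      apply mul_left_cancel₀ hp0
      rw [h, mul_sub, mul_one, ← pow_succ',
        Nat.sub_add_cancel (Nat.one_le_pow _ _ hp.out.pos)]
    have hd : ∀ n, (p : ℤ_[p]) ^ (n + 1) ∣ 1 - WittVector.ghostComponent n u := by
      intro n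
      rw [hg, sub_sub_cancel]
      apply pow_dvd_pow
      have := Nat.lt_pow_self (n := n + 1) hp.out.one_lt
      omega
    have hu' : ∀ n, ∃ b, WittVector.ghostComponent n u * b = 1 := by
      intro n
      rw [← isUnit_iff_exists_inv]
      by_contra hc
      have h1 : WittVector.ghostComponent n u ∈ IsLocalRing.maximalIdeal ℤ_[p] := hc
      rw [PadicInt.maximalIdeal_eq_span_p, Ideal.mem_span_singleton] at h1
      have h2 := dvd_add ((dvd_pow_self _ n.succ_ne_zero).trans (hd n)) h1
      rw [sub_add_cancel] at h2
      exact PadicInt.prime_p.not_isUnit (isUnit_of_dvd_one h2)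
    choose b hb using hu'
    have hb1 : ∀ n, (p : ℤ_[p]) ^ (n + 1) ∣ b n - 1 := by
      intro n
      have := (hd n).mul_right (b n)
      rwa [sub_mul, hb, one_mul] at this
    obtain ⟨y, hy⟩ := exists_ghost p b (by
      intro n
      have := dvd_sub ((pow_dvd_pow _ (Nat.le_succ _)).trans (hb1 (n + 1))) (hb1 n)
      rwa [sub_sub_sub_cancel_right] at this)
    refine IsUnit.of_mul_eq_one y (ghost_inj p _ _ fun n => ?_)
    rw [map_mul, hy, hb, map_one]
end

section
/- Let p be a prime and let u₀ ∈ W(ℤ_p) be the unique element with V(u₀) = p·1 − [p]. Then there exists a unique element α ∈ W(ℤ_p) such that α maps to 1 under the ring homomorphism W(ℤ_p) → W(𝔽_p) induced by the reduction ℤ_p → 𝔽_p and such that F(α)·u₀ = α; moreover α is a unit of W(ℤ_p). -/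
namespace ShearedWitt

open WittVector

variable {p : ℕ} [hp : Fact p.Prime]

theorem gc_sum (x : WittVector p ℤ_[p]) (n : ℕ) :
    ghostComponent n x = ∑ i ∈ Finset.range (n + 1), (p : ℤ_[p]) ^ i * x.coeff i ^ p ^ (n - i) := by
  rw [ghostComponent_apply, aeval_wittPolynomial]

theorem p_ne : (p : ℤ_[p]) ≠ 0 := by
  exact_mod_cast hp.out.ne_zero

theorem ghost_inj (x y : WittVector p ℤ_[p])
    (h : ∀ n, ghostComponent n x = ghostComponent n y) : x = y := by
  ext n
  induction n using Nat.strong_induction_on with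
  | _ n ih =>
    have h1 := h n
    rw [gc_sum, gc_sum, Finset.sum_range_succ, Finset.sum_range_succ,
      Finset.sum_congr rfl (fun i hi => by rw [ih i (Finset.mem_range.1 hi)])] at h1
    have h2 := add_left_cancel h1
    have h3 := mul_left_cancel₀ (pow_ne_zero n p_ne) h2
    simpa using h3

theorem map_eq_zero_iff (x : WittVector p ℤ_[p]) :
    WittVector.map (PadicInt.toZMod (p := p)) x = 0 ↔ ∀ n, (p : ℤ_[p]) ∣ x.coeff n := by
  have key : ∀ z : ℤ_[p], PadicInt.toZMod z = 0 ↔ (p : ℤ_[p]) ∣ z := by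
    intro z
    rw [← RingHom.mem_ker, PadicInt.ker_toZMod, PadicInt.maximalIdeal_eq_span_p,
      Ideal.mem_span_singleton]
  rw [WittVector.ext_iff]
  simp [WittVector.map_coeff, key]

theorem exp_le {i n : ℕ} (hi : i ≤ n) : n + 1 ≤ i + p ^ (n - i) := by
  have := Nat.lt_pow_self (n := n - i) hp.out.one_lt
  omega

theorem dvd_ghost (x : WittVector p ℤ_[p]) (h : ∀ n, (p : ℤ_[p]) ∣ x.coeff n) (n : ℕ) :
    (p : ℤ_[p]) ^ (n + 1) ∣ ghostComponent n x := by
  rw [gc_sum]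
  refine Finset.dvd_sum fun i hi => ?_
  refine (pow_dvd_pow _ (exp_le (p := p) (Nat.lt_succ_iff.1 (Finset.mem_range.1 hi)))).trans ?_
  rw [pow_add]
  exact mul_dvd_mul_left _ (pow_dvd_pow_of_dvd (h i) _)

noncomputable def cc (k : ℕ → ℤ_[p]) (n : ℕ) : ℤ_[p] :=
  k n - ∑ i : Fin n, (p : ℤ_[p]) ^ (i.1 + p ^ (n - i.1) - (n + 1)) * cc k i.1 ^ p ^ (n - i.1)
termination_by n
decreasing_by exact i.2

theorem exists_of_ghost (h : ℕ → ℤ_[p]) (hh : ∀ n, (p : ℤ_[p]) ^ (n + 1) ∣ h n) :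
    ∃ x : WittVector p ℤ_[p], (∀ n, (p : ℤ_[p]) ∣ x.coeff n) ∧
      ∀ n, ghostComponent n x = h n := by
  choose k hk using hh
  refine ⟨WittVector.mk p fun n => p * cc k n, fun n => ⟨_, rfl⟩, fun n => ?_⟩
  rw [gc_sum, Finset.sum_range_succ, hk n]
  simp only [WittVector.coeff_mk]
  have e := cc.eq_1 k n
  rw [Fin.sum_univ_eq_sum_range
    (fun i => (p : ℤ_[p]) ^ (i + p ^ (n - i) - (n + 1)) * cc k i ^ p ^ (n - i))] at e
  have e2 : k n = cc k n + ∑ i ∈ Finset.range n,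
      (p : ℤ_[p]) ^ (i + p ^ (n - i) - (n + 1)) * cc k i ^ p ^ (n - i) := by
    rw [e]; ring
  rw [e2, mul_add, Finset.mul_sum, add_comm]
  congr 1
  · simp; ring
  · refine Finset.sum_congr rfl fun i hi => ?_
    have := exp_le (p := p) (Finset.mem_range.1 hi).le
    rw [mul_pow, ← mul_assoc, ← mul_assoc, ← pow_add, ← pow_add]
    congr 2
    omega

theorem exists_of_ghost_one (g : ℕ → ℤ_[p]) (hg : ∀ n, (p : ℤ_[p]) ^ (n + 1) ∣ g n - 1) :
    ∃ x : WittVector p ℤ_[p], WittVector.map (PadicInt.toZMod (p := p)) x = 1 ∧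
      ∀ n, ghostComponent n x = g n := by
  obtain ⟨x, hx, hx2⟩ := exists_of_ghost (fun n => g n - 1) hg
  refine ⟨x + 1, ?_, fun n => ?_⟩
  · rw [map_add, (map_eq_zero_iff x).2 hx, map_one, zero_add]
  · rw [map_add, hx2, map_one]; ring

theorem ghost_one_of_map (x : WittVector p ℤ_[p])
    (hx : WittVector.map (PadicInt.toZMod (p := p)) x = 1) (n : ℕ) :
    (p : ℤ_[p]) ^ (n + 1) ∣ ghostComponent n x - 1 := by
  have := dvd_ghost (x - 1) ((map_eq_zero_iff _).1 (by rw [map_sub, hx, map_one, sub_self])) n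
  rwa [map_sub, map_one] at this

theorem isUnit_of_dvd (z : ℤ_[p]) (n : ℕ) (h : (p : ℤ_[p]) ^ (n + 1) ∣ z - 1) : IsUnit z := by
  have h1 : (p : ℤ_[p]) ∣ z - 1 := (dvd_pow_self _ n.succ_ne_zero).trans h
  by_contra hz
  have h2 : (p : ℤ_[p]) ∣ z := (PadicInt.norm_lt_one_iff_dvd z).1 (PadicInt.mem_nonunits.1 hz)
  have h3 : (p : ℤ_[p]) ∣ 1 := by simpa using dvd_sub h2 h1
  exact PadicInt.p_nonunit (isUnit_of_dvd_one h3)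

theorem isUnit_of_map (x : WittVector p ℤ_[p])
    (hx : WittVector.map (PadicInt.toZMod (p := p)) x = 1) : IsUnit x := by
  have h := ghost_one_of_map x hx
  have hu := fun n => (isUnit_of_dvd _ n (h n)).exists_right_inv
  choose g hg using hu
  obtain ⟨y, -, hy⟩ := exists_of_ghost_one g (fun n => by
    have : g n - 1 = (ghostComponent n x - 1) * (- g n) := by
      linear_combination hg n
    rw [this]
    exact (h n).mul_right _)
  refine IsUnit.of_mul_eq_one y (ghost_inj _ _ fun n => ?_)
  rw [map_mul, hy, hg, map_one]

theorem ghost_u (u₀ : WittVector p ℤ_[p])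
    (hu₀ : WittVector.verschiebung u₀ =
      (p : WittVector p ℤ_[p]) - WittVector.teichmuller p (p : ℤ_[p])) (n : ℕ) :
    (p : ℤ_[p]) ^ (n + 1) ∣ ghostComponent n u₀ - 1 := by
  have h := congrArg (ghostComponent (n + 1)) hu₀
  rw [ghostComponent_verschiebung, map_sub, map_natCast, ghostComponent_teichmuller] at h
  have hlt := Nat.lt_pow_self (n := n + 1) hp.out.one_lt
  obtain ⟨m, hm⟩ := Nat.exists_eq_add_of_lt hlt
  rw [hm] at h
  refine ⟨-(p : ℤ_[p]) ^ m, mul_left_cancel₀ p_ne ?_⟩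
  linear_combination h

theorem eq_of_dvd (a b : ℤ_[p]) (h : ∀ n, (p : ℤ_[p]) ^ n ∣ a - b) : a = b := by
  rw [← sub_eq_zero]
  apply IsHausdorff.haus' (I := IsLocalRing.maximalIdeal ℤ_[p])
  intro n
  rw [SModEq.zero, smul_eq_mul, Ideal.mul_top, PadicInt.maximalIdeal_eq_span_p,
    Ideal.span_singleton_pow, Ideal.mem_span_singleton]
  exact h n

theorem exists_lim (f : ℕ → ℤ_[p]) (h : ∀ n, (p : ℤ_[p]) ^ (n + 1) ∣ f (n + 1) - f n) :
    ∃ L, ∀ n, (p : ℤ_[p]) ^ (n + 1) ∣ L - f n := by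
  have key : ∀ (n : ℕ) (x y : ℤ_[p]), x ≡ y [SMOD
      ((IsLocalRing.maximalIdeal ℤ_[p]) ^ n • ⊤ : Submodule ℤ_[p] ℤ_[p])] ↔
      (p : ℤ_[p]) ^ n ∣ x - y := by
    intro n x y
    rw [SModEq.sub_mem, smul_eq_mul, Ideal.mul_top, PadicInt.maximalIdeal_eq_span_p,
      Ideal.span_singleton_pow, Ideal.mem_span_singleton]
  obtain ⟨L, hL⟩ := IsPrecomplete.prec' (I := IsLocalRing.maximalIdeal ℤ_[p]) f (by
    intro m n hmn
    induction n, hmn using Nat.le_induction with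
    | base => exact SModEq.refl _
    | succ n hmn ih =>
      refine ih.trans ((key _ _ _).2 ?_)
      rw [dvd_sub_comm]
      exact (pow_dvd_pow _ (by omega)).trans (h n))
  refine ⟨L, fun n => ?_⟩
  have h1 := (key _ _ _).1 (hL (n + 1))
  rw [dvd_sub_comm] at h1
  simpa using dvd_add h1 (h n)

end ShearedWitt

theorem sheared_witt_exists_unique_alpha (p : ℕ) [hp : Fact p.Prime]
    (u₀ : WittVector p ℤ_[p])
    (hu₀ : WittVector.verschiebung u₀ =
      (p : WittVector p ℤ_[p]) - WittVector.teichmuller p (p : ℤ_[p])) :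
    (∃! α : WittVector p ℤ_[p],
        WittVector.map (PadicInt.toZMod (p := p)) α = 1 ∧
        WittVector.frobenius α * u₀ = α) ∧
    (∀ α : WittVector p ℤ_[p],
        WittVector.map (PadicInt.toZMod (p := p)) α = 1 →
        WittVector.frobenius α * u₀ = α →
        IsUnit α) := by
  refine ⟨?_, fun α h _ => ShearedWitt.isUnit_of_map α h⟩
  have hu := ShearedWitt.ghost_u u₀ hu₀
  set v : ℕ → ℤ_[p] := fun n => WittVector.ghostComponent n u₀ with hv
  set q : ℕ → ℤ_[p] := fun n => ∏ i ∈ Finset.range n, v i with hq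
  have hqs : ∀ n, q (n + 1) = q n * v n := fun n => Finset.prod_range_succ _ _
  have hqu : ∀ n, IsUnit (q n) := by
    intro n
    induction n with
    | zero => simp [hq]
    | succ n ih =>
      rw [hqs]
      exact ih.mul (ShearedWitt.isUnit_of_dvd _ n (hu n))
  obtain ⟨L, hL⟩ := ShearedWitt.exists_lim q (fun n => by
    have : q (n + 1) - q n = (v n - 1) * q n := by rw [hqs]; ring
    rw [this]
    exact (hu n).mul_right _)
  have hgh : ∀ α : WittVector p ℤ_[p], WittVector.frobenius α * u₀ = α →
      ∀ n, WittVector.ghostComponent n α * q n = WittVector.ghostComponent 0 α := by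
    intro α hα n
    induction n with
    | zero => simp [hq]
    | succ n ih =>
      have h := congrArg (WittVector.ghostComponent n) hα
      rw [map_mul, WittVector.ghostComponent_frobenius] at h
      rw [← ih, ← h, hqs]
      ring
  have hzero : ∀ α : WittVector p ℤ_[p], WittVector.map (PadicInt.toZMod (p := p)) α = 1 →
      WittVector.frobenius α * u₀ = α → WittVector.ghostComponent 0 α = L := by
    intro α h1 hα
    refine ShearedWitt.eq_of_dvd _ _ fun n => (pow_dvd_pow _ n.le_succ).trans ?_
    have : WittVector.ghostComponent 0 α - L =
        (WittVector.ghostComponent n α - 1) * q n - (L - q n) := by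
      rw [← hgh α hα n]; ring
    rw [this]
    exact dvd_sub ((ShearedWitt.ghost_one_of_map α h1 n).mul_right _) (hL n)
  choose r hr using fun n => (hqu n).exists_right_inv
  obtain ⟨α, h1, hα⟩ := ShearedWitt.exists_of_ghost_one (fun n => L * r n) (fun n => by
    have : L * r n - 1 = (L - q n) * r n := by linear_combination hr n
    rw [this]
    exact (hL n).mul_right _)
  refine ⟨α, ⟨h1, ShearedWitt.ghost_inj _ _ fun n => ?_⟩, ?_⟩
  · rw [map_mul, WittVector.ghostComponent_frobenius, hα, hα]
    have h2 := hr (n + 1)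
    rw [hqs] at h2
    change L * r (n + 1) * v n = L * r n
    linear_combination (-L * r (n + 1) * v n) * hr n + L * r n * h2
  · rintro β ⟨hb1, hb⟩
    refine ShearedWitt.ghost_inj _ _ fun n => ?_
    have h2 := hgh β hb n
    rw [hzero β hb1 hb] at h2
    rw [hα, ← h2, mul_assoc, hr, mul_one]
end

section
/- Let p be a prime and let R → R' be a faithfully flat homomorphism of commutative rings. Then the augmented Čech complex of the p-typical Witt vector functor, W(R) → W(R') → W(R' ⊗_R R') → W(R' ⊗_R R' ⊗_R R') → ⋯, is acyclic, i.e., exact at every term (in particular W(R) → W(R') is injective with image the equalizer of the two maps to W(R' ⊗_R R'), and all higher Čech cohomology groups Ȟ^i(R'/R, W) for i ≥ 1 vanish). -/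
/-!
STATEMENT 4: Let p be a prime and let R → R' be a faithfully flat homomorphism of
commutative rings.  Then the augmented Čech complex of the p-typical Witt vector
functor, W(R) → W(R') → W(R' ⊗_R R') → W(R' ⊗_R R' ⊗_R R') → ⋯, is acyclic.
-/

open TensorProduct

universe u

variable {R : Type u} [CommRing R]

section WittGeneric

variable {p : ℕ} [hp : Fact p.Prime] {A B C : Type u} [CommRing A] [CommRing B] [CommRing C]

lemma wittAux_decomp (x : WittVector p A) :
    x = WittVector.teichmuller p (x.coeff 0) +
      WittVector.verschiebung (WittVector.mk p fun n => x.coeff (n + 1)) := by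
  ext n
  rw [WittVector.coeff_add_of_disjoint]
  · cases n with
    | zero => simp
    | succ n => simp [WittVector.teichmuller_coeff_pos]
  · intro n
    cases n with
    | zero => right; simp
    | succ n => left; simp [WittVector.teichmuller_coeff_pos]

lemma wittAux_exact (D : WittVector p A →+ WittVector p B) (E : WittVector p B →+ WittVector p C)
    (d : A → B) (e : B → C)
    (hDV : ∀ x, D (WittVector.verschiebung x) = WittVector.verschiebung (D x))
    (hEV : ∀ x, E (WittVector.verschiebung x) = WittVector.verschiebung (E x))
    (hD : ∀ x, (D x).coeff 0 = d (x.coeff 0))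
    (hE : ∀ x, (E x).coeff 0 = e (x.coeff 0))
    (hED : ∀ x, E (D x) = 0)
    (hde : ∀ b, e b = 0 → ∃ a, d a = b)
    (x : WittVector p B) (hx : E x = 0) : ∃ y, D y = x := by
  have step : ∀ x : {x : WittVector p B // E x = 0}, ∃ (a : A) (x' : {x : WittVector p B // E x = 0}),
      x.1 = D (WittVector.teichmuller p a) + WittVector.verschiebung x'.1 := by
    rintro ⟨x, hx⟩
    obtain ⟨a, ha⟩ := hde (x.coeff 0) (by rw [← hE, hx]; simp)
    have h0 : (x - D (WittVector.teichmuller p a)).coeff 0 = 0 := by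
      have : (WittVector.constantCoeff (p := p)) (x - D (WittVector.teichmuller p a)) = 0 := by
        rw [map_sub]
        change x.coeff 0 - (D _).coeff 0 = 0
        rw [hD, WittVector.teichmuller_coeff_zero, ha, sub_self]
      exact this
    have h1 := wittAux_decomp (x - D (WittVector.teichmuller p a))
    rw [h0, WittVector.teichmuller_zero, zero_add] at h1
    refine ⟨a, ⟨WittVector.mk p fun n => (x - D (WittVector.teichmuller p a)).coeff (n + 1), ?_⟩, ?_⟩
    · apply WittVector.verschiebung_injective p
      rw [← hEV, ← h1, map_sub, hx, hED, sub_self, map_zero]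
    · rw [← h1]; abel
  choose a f haf using step
  let z : {x : WittVector p B // E x = 0} → WittVector p A :=
    fun x => WittVector.mk p fun n => a (f^[n] x)
  have hz : ∀ x, z x = WittVector.teichmuller p (a x) + WittVector.verschiebung (z (f x)) := by
    intro x
    exact wittAux_decomp (z x)
  have key : ∀ x, x.1 - D (z x) = WittVector.verschiebung ((f x).1 - D (z (f x))) := by
    intro x
    rw [map_sub, ← hDV]
    conv_lhs => rw [hz x, map_add, haf x]
    abel
  have hzero : ∀ n x, (x.1 - D (z x)).coeff n = 0 := by
    intro n
    induction n with
    | zero => intro x; rw [key, WittVector.verschiebung_coeff_zero]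
    | succ n ih => intro x; rw [key, WittVector.verschiebung_coeff_succ, ih]
  refine ⟨z ⟨x, hx⟩, ?_⟩
  have : x - D (z ⟨x, hx⟩) = 0 := by
    ext n
    rw [hzero n ⟨x, hx⟩]; simp
  exact (sub_eq_zero.mp this).symm

end WittGeneric

lemma cechAux_d_squared {A B C : Type*} [AddCommGroup A] [AddCommGroup B] [AddCommGroup C] (n : ℕ)
    (φ : Fin (n + 2) → A →+ B) (ψ : Fin (n + 3) → B →+ C)
    (h : ∀ i j : Fin (n + 2), i ≤ j → ∀ a, ψ j.succ (φ i a) = ψ i.castSucc (φ j a)) (a : A) :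
    ∑ j : Fin (n + 3), (-1 : ℤ) ^ (j : ℕ) • ψ j (∑ i : Fin (n + 2), (-1 : ℤ) ^ (i : ℕ) • φ i a)
      = 0 := by
  simp only [map_sum, map_zsmul, Finset.smul_sum, smul_smul]
  rw [Finset.sum_comm]
  simp only [← Finset.sum_product']
  let P := Fin (n + 2) × Fin (n + 3)
  let S : Finset P := {ij : P | (ij.2 : ℕ) ≤ (ij.1 : ℕ)}
  rw [Finset.univ_product_univ, ← Finset.sum_add_sum_compl S, ← eq_neg_iff_add_eq_zero,
    ← Finset.sum_neg_distrib]
  let φ' : ∀ ij : P, ij ∈ S → P := fun ij hij =>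
    (Fin.castLT ij.2 (lt_of_le_of_lt (Finset.mem_filter.mp hij).right (Fin.is_lt ij.1)), ij.1.succ)
  apply Finset.sum_bij φ'
  · intro ij hij
    simp_rw [S, φ', Finset.compl_filter, Finset.mem_filter_univ, Fin.val_succ,
      Fin.val_castLT] at hij ⊢
    lia
  · rintro ⟨i, j⟩ hij ⟨i', j'⟩ hij' h
    rw [Prod.mk_inj]
    exact ⟨by simpa [φ'] using! congr_arg Prod.snd h,
      by simpa [φ', Fin.castSucc_castLT] using! congr_arg Fin.castSucc (congr_arg Prod.fst h)⟩
  · rintro ⟨i', j'⟩ hij'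
    simp_rw [S, Finset.compl_filter, Finset.mem_filter_univ, not_le] at hij'
    refine ⟨(j'.pred <| ?_, Fin.castSucc i'), ?_, ?_⟩
    · rintro rfl
      simp only [Fin.val_zero, not_lt_zero] at hij'
    · simpa [S] using! Nat.le_sub_one_of_lt hij'
    · simp only [φ', Fin.castLT_castSucc, Fin.succ_pred]
  · rintro ⟨i, j⟩ hij
    have hij2 : (j : ℕ) ≤ (i : ℕ) := by simpa [S] using! hij
    have := h (Fin.castLT j (lt_of_le_of_lt hij2 i.is_lt)) i (by
      rw [Fin.le_def]; simpa using hij2) a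
    rw [Fin.castSucc_castLT] at this
    simp only [φ']
    rw [this, ← neg_smul]
    congr 1
    simp only [Fin.val_succ, Fin.val_castLT, pow_add, pow_one]
    ring

section Cech

variable (R' : Type u) [CommRing R'] [Algebra R R']

open TensorProduct

/-- The pure tensor `a ⊗ r`, typed as an element of the next tensor power. -/
noncomputable def cechT (n : ℕ) : (cechAlg (R := R) R' n).carrier →ₗ[R] R' →ₗ[R]
    (cechAlg (R := R) R' (n + 1)).carrier :=
  TensorProduct.mk R (cechAlg (R := R) R' n).carrier _

/-- The identity map from `R'` to the first term. -/
noncomputable def cechE : R' →ₐ[R] (cechAlg (R := R) R' 0).carrier := AlgHom.id R _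

/-- The identity map from the first term to `R'`. -/
noncomputable def cechF : (cechAlg (R := R) R' 0).carrier →ₐ[R] R' := AlgHom.id R _

lemma cechE_cechF (a : (cechAlg (R := R) R' 0).carrier) : cechE R' (cechF R' a) = a := rfl

lemma cechIns_zero_zero (a : (cechAlg (R := R) R' 0).carrier) :
    cechIns (R := R) R' 0 0 a = cechT R' 0 1 (cechF R' a) := rfl

lemma cechIns_last : ∀ (n : ℕ) (a : (cechAlg (R := R) R' n).carrier),
    cechIns (R := R) R' n (Fin.last (n + 1)) a = cechT R' n a 1
  | 0, a => rfl
  | n + 1, a => by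
    have h : cechIns (R := R) R' (n + 1) (Fin.last (n + 1 + 1)) =
        (Algebra.TensorProduct.includeLeft : (cechAlg (R := R) R' (n + 1)).carrier →ₐ[R]
          (cechAlg (R := R) R' (n + 1)).carrier ⊗[R] R') := by
      rw [cechIns]
      exact Fin.lastCases_last
    rw [h]
    rfl

lemma cechIns_castSucc (n : ℕ) (j : Fin (n + 2)) (a : (cechAlg (R := R) R' n).carrier)
    (r : R') : cechIns (R := R) R' (n + 1) j.castSucc (cechT R' n a r) =
      cechT R' (n + 1) (cechIns R' n j a) r := by
  have h : cechIns (R := R) R' (n + 1) j.castSucc =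
      (Algebra.TensorProduct.map (cechIns R' n j) (AlgHom.id R R') :
        (cechAlg (R := R) R' n).carrier ⊗[R] R' →ₐ[R]
          (cechAlg (R := R) R' (n + 1)).carrier ⊗[R] R') := by
    rw [cechIns]
    exact Fin.lastCases_castSucc _
  rw [h]
  rfl

/-- Two additive maps out of a term of the complex that agree on pure tensors agree. -/
lemma cech_ext {n : ℕ} {B : Type*} [AddCommMonoid B]
    (f g : (cechAlg (R := R) R' (n + 1)).carrier →+ B)
    (h : ∀ (a : (cechAlg (R := R) R' n).carrier) (r : R'), f (cechT R' n a r) = g (cechT R' n a r))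
    (x : (cechAlg (R := R) R' (n + 1)).carrier) : f x = g x := by
  have main : ∀ (f g : (cechAlg (R := R) R' n).carrier ⊗[R] R' →+ B),
      (∀ (a : (cechAlg (R := R) R' n).carrier) (r : R'), f (a ⊗ₜ[R] r) = g (a ⊗ₜ[R] r)) →
      ∀ x, f x = g x := by
    intro f g h x
    induction x using TensorProduct.induction_on with
    | zero => rw [map_zero, map_zero]
    | tmul a r => exact h a r
    | add x y hx hy => rw [map_add, map_add, hx, hy]
  exact main f g h x

lemma cechIns_comp : ∀ (n : ℕ) (i j : Fin (n + 2)), i ≤ j →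
    ∀ a, cechIns (R := R) R' (n + 1) j.succ (cechIns R' n i a) =
      cechIns R' (n + 1) i.castSucc (cechIns R' n j a)
  | n, i, j, hij, a => by
    induction j using Fin.lastCases with
    | last =>
      rw [Fin.succ_last, cechIns_last, cechIns_last, cechIns_castSucc]
    | cast j =>
      induction i using Fin.lastCases with
      | last => exact absurd hij (by rw [Fin.le_def]; simp; omega)
      | cast i =>
        have hij' : i ≤ j := by simpa using hij
        rw [Fin.succ_castSucc]
        cases n with
        | zero =>
          obtain rfl : i = (0 : Fin 1) := Fin.fin_one_eq_zero i
          obtain rfl : j = (0 : Fin 1) := Fin.fin_one_eq_zero j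
          have h0 : cechIns (R := R) R' 0 (Fin.castSucc (0 : Fin 1)) a =
            cechT R' 0 1 (cechF R' a) := cechIns_zero_zero R' a
          rw [h0, cechIns_castSucc, cechIns_castSucc, map_one (cechIns (R := R) R' 0 _),
            map_one (cechIns (R := R) R' 0 _)]
        | succ n =>
          let f (i j) : (cechAlg (R := R) R' (n + 1)).carrier →+
              (cechAlg (R := R) R' (n + 1 + 1 + 1)).carrier :=
            (RingHom.comp (cechIns (R := R) R' (n + 1 + 1) j).toRingHom
              (cechIns (R := R) R' (n + 1) i).toRingHom).toAddMonoidHom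
          refine cech_ext R' (f i.castSucc j.succ.castSucc)
            (f j.castSucc i.castSucc.castSucc) ?_ a
          intro a r
          change cechIns (R := R) R' (n + 1 + 1) j.succ.castSucc
              (cechIns R' (n + 1) i.castSucc (cechT R' n a r)) =
            cechIns (R := R) R' (n + 1 + 1) i.castSucc.castSucc
              (cechIns R' (n + 1) j.castSucc (cechT R' n a r))
          rw [cechIns_castSucc, cechIns_castSucc, cechIns_castSucc, cechIns_castSucc,
            cechIns_comp n i j hij' a]

/-- The Čech differential for the additive group. -/
noncomputable def cechD (n : ℕ) :
    (cechAlg (R := R) R' n).carrier →ₗ[R] (cechAlg (R := R) R' (n + 1)).carrier :=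
  ∑ i : Fin (n + 2), (-1 : ℤ) ^ (i : ℕ) • (cechIns (R := R) R' n i).toLinearMap

lemma cechD_apply (n : ℕ) (x : (cechAlg (R := R) R' n).carrier) :
    cechD R' n x = ∑ i : Fin (n + 2), (-1 : ℤ) ^ (i : ℕ) • cechIns (R := R) R' n i x := by
  simp [cechD, LinearMap.sum_apply]

lemma cechD_cechD (n : ℕ) (x : (cechAlg (R := R) R' n).carrier) :
    cechD R' (n + 1) (cechD R' n x) = 0 := by
  rw [cechD_apply, cechD_apply]
  let F (n) (i : Fin (n + 2)) : (cechAlg (R := R) R' n).carrier →+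
    (cechAlg (R := R) R' (n + 1)).carrier := (cechIns (R := R) R' n i).toRingHom.toAddMonoidHom
  exact cechAux_d_squared n (F n) (F (n + 1)) (fun i j hij a => cechIns_comp R' n i j hij a) x

lemma cechD_succ_tmul (n : ℕ) (a : (cechAlg (R := R) R' n).carrier) (r : R') :
    cechD (R := R) R' (n + 1) (cechT R' n a r) =
      cechT R' (n + 1) (cechD R' n a) r +
      (-1 : ℤ) ^ (n + 2) • cechT R' (n + 1) (cechT R' n a r) 1 := by
  rw [cechD_apply, Fin.sum_univ_castSucc, cechIns_last, cechD_apply, map_sum, LinearMap.sum_apply]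
  congr 1
  refine Finset.sum_congr rfl fun i _ => ?_
  rw [cechIns_castSucc, map_zsmul, LinearMap.smul_apply, Fin.val_castSucc]

/-- The contracting homotopy: multiply the last two factors. -/
noncomputable def cechH (n : ℕ) :
    (cechAlg (R := R) R' (n + 1)).carrier ⊗[R] R' →ₗ[R] (cechAlg (R := R) R' n).carrier ⊗[R] R' :=
  (LinearMap.lTensor _ (LinearMap.mul' R R')) ∘ₗ
    (TensorProduct.assoc R (cechAlg (R := R) R' n).carrier R' R').toLinearMap

lemma cechH_tmul (n : ℕ) (a : (cechAlg (R := R) R' n).carrier) (r s : R') :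
    cechH R' n (cechT R' n a r ⊗ₜ[R] s) = a ⊗ₜ[R] (r * s) := rfl

lemma cech_homotopy (n : ℕ) (x : (cechAlg (R := R) R' (n + 1)).carrier ⊗[R] R') :
    cechH (R := R) R' (n + 1) ((cechD (R := R) R' (n + 1)).rTensor R' x) =
      (cechD (R := R) R' n).rTensor R' (cechH R' n x) + (-1 : ℤ) ^ (n + 2) • x := by
  induction x using TensorProduct.induction_on with
  | zero => simp
  | add x y hx hy => simp only [map_add, hx, hy, smul_add]; abel
  | tmul x s =>
    let T : (cechAlg (R := R) R' (n + 1)).carrier →ₗ[R]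
      (cechAlg (R := R) R' (n + 1)).carrier ⊗[R] R' := (TensorProduct.mk R _ R').flip s
    refine cech_ext R'
      ((cechH (R := R) R' (n + 1) ∘ₗ (cechD (R := R) R' (n + 1)).rTensor R') ∘ₗ T).toAddMonoidHom
      (((cechD (R := R) R' n).rTensor R' ∘ₗ cechH R' n + (-1 : ℤ) ^ (n + 2) • LinearMap.id)
        ∘ₗ T).toAddMonoidHom ?_ x
    intro a r
    change cechH (R := R) R' (n + 1) ((cechD (R := R) R' (n + 1) (cechT R' n a r)) ⊗ₜ[R] s) =
      (cechD (R := R) R' n).rTensor R' (cechH R' n (cechT R' n a r ⊗ₜ[R] s)) +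
        (-1 : ℤ) ^ (n + 2) • (cechT R' n a r ⊗ₜ[R] s)
    rw [cechD_succ_tmul, TensorProduct.add_tmul, map_add, ← TensorProduct.smul_tmul', map_zsmul,
      cechH_tmul, cechH_tmul, cechH_tmul, one_mul, LinearMap.rTensor_tmul]

lemma cech_homotopy_zero (x : (cechAlg (R := R) R' 0).carrier ⊗[R] R') :
    cechH (R := R) R' 0 ((cechD (R := R) R' 0).rTensor R' x) =
      (Algebra.linearMap R (cechAlg (R := R) R' 0).carrier).rTensor R'
        ((TensorProduct.lid R R').symm (LinearMap.mul' R R'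
          ((cechF R').toLinearMap.rTensor R' x))) - x := by
  induction x using TensorProduct.induction_on with
  | zero => simp
  | add x y hx hy => simp only [map_add, hx, hy]; abel
  | tmul a s =>
    have h1 : cechD (R := R) R' 0 a = cechT R' 0 1 (cechF R' a) - cechT R' 0 a 1 := by
      rw [cechD_apply, Fin.sum_univ_castSucc, cechIns_last, Fin.sum_univ_one, Fin.castSucc_zero,
        cechIns_zero_zero]
      simp [sub_eq_add_neg]
    rw [LinearMap.rTensor_tmul, LinearMap.rTensor_tmul, h1, TensorProduct.sub_tmul, map_sub,
      cechH_tmul, cechH_tmul, one_mul, LinearMap.mul'_apply, TensorProduct.lid_symm_apply,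
      LinearMap.rTensor_tmul, Algebra.linearMap_apply, map_one]
    rfl

lemma cechD_exact [Module.FaithfullyFlat R R'] (n : ℕ) :
    Function.Exact (cechD (R := R) R' n) (cechD (R := R) R' (n + 1)) := by
  apply Module.FaithfullyFlat.rTensor_reflects_exact R R'
  intro x
  constructor
  · intro hx
    have h := cech_homotopy (R := R) R' n x
    rw [hx, map_zero] at h
    refine ⟨-((-1 : ℤ) ^ (n + 2) • cechH R' n x), ?_⟩
    rw [map_neg, map_zsmul, eq_neg_of_add_eq_zero_left h.symm, smul_neg, smul_smul, neg_neg,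
      ← mul_pow]
    simp
  · rintro ⟨y, rfl⟩
    have : cechD (R := R) R' (n + 1) ∘ₗ cechD R' n = 0 :=
      LinearMap.ext fun x => cechD_cechD R' n x
    rw [← LinearMap.comp_apply, ← LinearMap.rTensor_comp, this]
    simp

lemma cechD_exact_zero [Module.FaithfullyFlat R R'] :
    Function.Exact (Algebra.linearMap R (cechAlg (R := R) R' 0).carrier)
      (cechD (R := R) R' 0) := by
  apply Module.FaithfullyFlat.rTensor_reflects_exact R R'
  intro x
  constructor
  · intro hx
    have h := cech_homotopy_zero (R := R) R' x
    rw [hx, map_zero] at h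
    exact ⟨_, sub_eq_zero.mp h.symm⟩
  · rintro ⟨y, rfl⟩
    have : cechD (R := R) R' 0 ∘ₗ Algebra.linearMap R _ = 0 := by
      apply LinearMap.ext
      intro r
      rw [LinearMap.comp_apply, Algebra.linearMap_apply, cechD_apply, Fin.sum_univ_two,
        AlgHom.commutes, AlgHom.commutes]
      simp
    rw [← LinearMap.comp_apply, ← LinearMap.rTensor_comp, this]
    simp

variable (p : ℕ) [hp : Fact p.Prime]

lemma cechWittD_apply (n : ℕ) (x : WittVector p (cechAlg (R := R) R' n).carrier) :
    cechWittD p R' n x = ∑ i : Fin (n + 2), (-1 : ℤ) ^ (i : ℕ) •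
      WittVector.map (p := p) ((cechIns (R := R) R' n i) : _ →+* _) x := by
  simp [cechWittD]

lemma cechWittD_verschiebung (n : ℕ) (x : WittVector p (cechAlg (R := R) R' n).carrier) :
    cechWittD p R' n (WittVector.verschiebung x) =
      WittVector.verschiebung (cechWittD p R' n x) := by
  simp only [cechWittD_apply, map_sum, map_zsmul, WittVector.map_verschiebung]

lemma cechWittD_coeff_zero (n : ℕ) (x : WittVector p (cechAlg (R := R) R' n).carrier) :
    (cechWittD p R' n x).coeff 0 = cechD R' n (x.coeff 0) := by
  change WittVector.constantCoeff (p := p) (cechWittD p R' n x) = _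
  simp only [cechWittD_apply, cechD_apply, map_sum, map_zsmul]
  rfl

lemma cechWittD_cechWittD (n : ℕ) (x : WittVector p (cechAlg (R := R) R' n).carrier) :
    cechWittD p R' (n + 1) (cechWittD p R' n x) = 0 := by
  rw [cechWittD_apply, cechWittD_apply]
  let F (n) (i : Fin (n + 2)) : WittVector p (cechAlg (R := R) R' n).carrier →+
      WittVector p (cechAlg (R := R) R' (n + 1)).carrier :=
    (WittVector.map (p := p) (cechIns (R := R) R' n i : _ →+* _)).toAddMonoidHom
  refine cechAux_d_squared n (F n) (F (n + 1)) (fun i j hij a => ?_) x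
  ext k
  exact cechIns_comp R' n i j hij (a.coeff k)

lemma cechWittD_map (y : WittVector p R) :
    cechWittD p R' 0
      (WittVector.map (algebraMap R (cechAlg (R := R) R' 0).carrier) y) = 0 := by
  rw [cechWittD_apply, Fin.sum_univ_two]
  have : ∀ i : Fin (0 + 2), WittVector.map (p := p) (RingHomClass.toRingHom (cechIns (R := R) R' 0 i))
      (WittVector.map (algebraMap R _) y) = WittVector.map (algebraMap R _) y := by
    intro i
    ext k
    exact (cechIns (R := R) R' 0 i).commutes (y.coeff k)
  rw [this, this]
  simp

end Cech

theorem witt_cech_acyclic_of_faithfullyFlat (p : ℕ) [Fact p.Prime]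
    (R R' : Type u) [CommRing R] [CommRing R'] [Algebra R R']
    [Module.FaithfullyFlat R R'] :
    Function.Injective (WittVector.map (p := p) (algebraMap R R')) ∧
    (∀ x : WittVector p (cechAlg (R := R) R' 0).carrier,
        cechWittD p R' 0 x = 0 ↔
          ∃ y : WittVector p R, WittVector.map (algebraMap R R') y = x) ∧
    (∀ (n : ℕ) (x : WittVector p (cechAlg (R := R) R' (n + 1)).carrier),
        cechWittD p R' (n + 1) x = 0 ↔ ∃ y, cechWittD p R' n y = x) := by
  refine ⟨?_, ?_, ?_⟩
  · exact WittVector.map_injective _ (FaithfulSMul.algebraMap_injective R R')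
  · intro x
    constructor
    · intro hx
      exact wittAux_exact (WittVector.map (p := p)
          (algebraMap R (cechAlg (R := R) R' 0).carrier)).toAddMonoidHom
        (cechWittD (R := R) p R' 0) (algebraMap R (cechAlg (R := R) R' 0).carrier) (cechD (R := R) R' 0)
        (fun x => WittVector.map_verschiebung _ x) (cechWittD_verschiebung R' p 0)
        (fun x => rfl) (cechWittD_coeff_zero R' p 0) (cechWittD_map R' p)
        (fun b hb => (cechD_exact_zero (R := R) R' b).1 hb) x hx
    · rintro ⟨y, rfl⟩
      exact cechWittD_map R' p y
  · intro n x
    constructor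
    · intro hx
      exact wittAux_exact (cechWittD (R := R) p R' n)
        (cechWittD (R := R) p R' (n + 1)) (cechD (R := R) R' n) (cechD (R := R) R' (n + 1))
        (cechWittD_verschiebung R' p n) (cechWittD_verschiebung R' p (n + 1))
        (cechWittD_coeff_zero R' p n) (cechWittD_coeff_zero R' p (n + 1))
        (cechWittD_cechWittD R' p n)
        (fun b hb => (cechD_exact (R := R) R' n b).1 hb) x hx
    · rintro ⟨y, rfl⟩
      exact cechWittD_cechWittD R' p n y
end
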